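/- arXiv:1404.3155 — 3 statements merged into one kernel-verified Lean document; each statement's English description precedes it below -/
import Mathlib

section
/- A finite simple graph has special treewidth at most two if and only if every connected component of it is a mamba tree. -/
open SimpleGraph

/-- The cycle graph on `ZMod n` (for `3 ≤ n` this is a cycle of length `n`). -/
def cycGraph (n : ℕ) : SimpleGraph (ZMod n) :=
  SimpleGraph.fromRel (fun x y => x = y + 1)

/-- The set `s` of nodes induces a path in the graph `H`. -/
def IsPathSet {ι : Type} (H : SimpleGraph ι) (s : Set ι) : Prop :=
  (H.induce s).Connected ∧ ∀ x ∈ s, {y | y ∈ s ∧ H.Adj x y}.ncard ≤ 2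

/-- The set `s` of nodes induces a directed path in `H` with respect to the
orientation `o` of the edges of `H`. -/
def IsDirPathSet {ι : Type} (H : SimpleGraph ι) (o : ι → ι → Prop) (s : Set ι) : Prop :=
  IsPathSet H s ∧ (∀ x ∈ s, {y | y ∈ s ∧ o x y}.ncard ≤ 1) ∧
    (∀ x ∈ s, {y | y ∈ s ∧ o y x}.ncard ≤ 1)

/-- A tree decomposition of a finite simple graph `G`. -/
structure TreeDecomp {V : Type} (G : SimpleGraph V) where
  ι : Type
  finι : Finite ι
  tree : SimpleGraph ι
  isTree : tree.IsTree
  bag : ι → Set V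
  bag_cover : ∀ v : V, ∃ x, v ∈ bag x
  bag_edge : ∀ ⦃u v : V⦄, G.Adj u v → ∃ x, u ∈ bag x ∧ v ∈ bag x
  bag_conn : ∀ v : V, (tree.induce {x | v ∈ bag x}).Connected

/-- A spaghetti tree decomposition: for every vertex `v` of `G`, the nodes whose
bags contain `v` induce a path in the tree. -/
structure SpaghettiTD {V : Type} (G : SimpleGraph V) extends TreeDecomp G where
  bag_path : ∀ v : V, IsPathSet tree {x | v ∈ bag x}

/-- A directed spaghetti tree decomposition: the tree edges are oriented, and for
every vertex `v` of `G` the nodes whose bags contain `v` induce a directed path. -/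
structure DirSpaghettiTD {V : Type} (G : SimpleGraph V) extends TreeDecomp G where
  orient : ι → ι → Prop
  orient_iff : ∀ x y : ι, tree.Adj x y ↔ (orient x y ∨ orient y x)
  orient_asymm : ∀ x y : ι, orient x y → ¬ orient y x
  bag_dirpath : ∀ v : V, IsDirPathSet tree orient {x | v ∈ bag x}

/-- A special tree decomposition: the tree is rooted, and for every vertex `v` of
`G` the nodes whose bags contain `v` induce a vertical path, i.e. a directed path
with respect to the orientation of every tree edge towards the root. -/
structure SpecialTD {V : Type} (G : SimpleGraph V) extends TreeDecomp G where
  root : ι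
  bag_vertical : ∀ v : V,
    IsDirPathSet tree (fun x y => tree.Adj x y ∧ tree.dist y root < tree.dist x root)
      {x | v ∈ bag x}

/-- A path decomposition of a finite simple graph `G`. -/
structure PathDecomp {V : Type} (G : SimpleGraph V) where
  m : ℕ
  hm : 0 < m
  bag : Fin m → Set V
  bag_cover : ∀ v : V, ∃ i, v ∈ bag i
  bag_edge : ∀ ⦃u v : V⦄, G.Adj u v → ∃ i, u ∈ bag i ∧ v ∈ bag i
  bag_convex : ∀ (v : V) (i j k : Fin m), i ≤ j → j ≤ k → v ∈ bag i → v ∈ bag k → v ∈ bag j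

/-- Treewidth: minimal width of a tree decomposition. -/
noncomputable def treewidth {V : Type} (G : SimpleGraph V) : ℕ :=
  sInf {k | ∃ td : TreeDecomp G, ∀ x, (td.bag x).ncard ≤ k + 1}

/-- Spaghetti treewidth: minimal width of a spaghetti tree decomposition. -/
noncomputable def sptw {V : Type} (G : SimpleGraph V) : ℕ :=
  sInf {k | ∃ td : SpaghettiTD G, ∀ x, (td.bag x).ncard ≤ k + 1}

/-- Directed spaghetti treewidth: minimal width of a directed spaghetti tree
decomposition. -/
noncomputable def dptw {V : Type} (G : SimpleGraph V) : ℕ :=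
  sInf {k | ∃ td : DirSpaghettiTD G, ∀ x, (td.bag x).ncard ≤ k + 1}

/-- Special treewidth: minimal width of a special tree decomposition. -/
noncomputable def spctw {V : Type} (G : SimpleGraph V) : ℕ :=
  sInf {k | ∃ td : SpecialTD G, ∀ x, (td.bag x).ncard ≤ k + 1}

/-- Pathwidth: minimal width of a path decomposition. -/
noncomputable def pw {V : Type} (G : SimpleGraph V) : ℕ :=
  sInf {k | ∃ pd : PathDecomp G, ∀ i, (pd.bag i).ncard ≤ k + 1}

/-- A graph is chordal iff it has no induced (i.e. chordless) cycle of length at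
least four. -/
def IsChordal {V : Type} (G : SimpleGraph V) : Prop :=
  ∀ (S : Set V) (n : ℕ), 4 ≤ n → ¬ Nonempty ((G.induce S) ≃g cycGraph n)

/-- A graph is strongly chordal if it is chordal and every even cycle of length at
least six has an odd chord: a chord splitting the cycle into two odd paths of
length at least three. -/
def IsStronglyChordal {V : Type} (G : SimpleGraph V) : Prop :=
  IsChordal G ∧ ∀ n : ℕ, 6 ≤ n → Even n → ∀ f : ZMod n → V,
    Function.Injective f → (∀ i : ZMod n, G.Adj (f i) (f (i + 1))) →
      ∃ (i : ZMod n) (d : ℕ), Odd d ∧ 3 ≤ d ∧ d + 3 ≤ n ∧ G.Adj (f i) (f (i + (d : ZMod n)))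

/-- Strongly chordal treewidth: the minimum of `ω(H) - 1` over all strongly chordal
supergraphs `H` of `G` (on the same vertex set; here `ω(H) ≤ k + 1` is expressed as
`H.CliqueFree (k + 2)`). -/
noncomputable def sctw {V : Type} (G : SimpleGraph V) : ℕ :=
  sInf {k | ∃ H : SimpleGraph V, G ≤ H ∧ IsStronglyChordal H ∧ H.CliqueFree (k + 2)}

/-- `H` is a minor of `G`: there is a family of nonempty, pairwise disjoint,
connected branch sets in `G`, one for each vertex of `H`, such that every edge of
`H` is realized by an edge of `G` between the corresponding branch sets. -/
def IsMinorOf {W V : Type} (H : SimpleGraph W) (G : SimpleGraph V) : Prop :=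
  ∃ f : W → Set V,
    (∀ w, (f w).Nonempty) ∧ (∀ w, (G.induce (f w)).Connected) ∧
    (Pairwise fun w w' => Disjoint (f w) (f w')) ∧
    ∀ ⦃w w'⦄, H.Adj w w' → ∃ u ∈ f w, ∃ v ∈ f w', G.Adj u v

/-- The complete graph on four vertices. -/
def K4 : SimpleGraph (Fin 4) := ⊤

/-- `D₃`: two vertices (`0` and `1`) joined by three internally vertex-disjoint
paths of length three. -/
def D3 : SimpleGraph (Fin 8) := SimpleGraph.fromRel (fun x y =>
  (x = 0 ∧ y = 2) ∨ (x = 2 ∧ y = 3) ∨ (x = 3 ∧ y = 1) ∨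
  (x = 0 ∧ y = 4) ∨ (x = 4 ∧ y = 5) ∨ (x = 5 ∧ y = 1) ∨
  (x = 0 ∧ y = 6) ∨ (x = 6 ∧ y = 7) ∨ (x = 7 ∧ y = 1))

/-- `S₃` (the 3-sun): a 6-cycle `0 1 2 3 4 5` together with the triangle `1 3 5`. -/
def S3 : SimpleGraph (Fin 6) := SimpleGraph.fromRel (fun x y =>
  (x = 0 ∧ y = 1) ∨ (x = 1 ∧ y = 2) ∨ (x = 2 ∧ y = 3) ∨ (x = 3 ∧ y = 4) ∨
  (x = 4 ∧ y = 5) ∨ (x = 5 ∧ y = 0) ∨ (x = 1 ∧ y = 3) ∨ (x = 3 ∧ y = 5) ∨ (x = 5 ∧ y = 1))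

/-- A graph is 2-connected if it has at least three vertices and deleting any one
vertex leaves it connected. -/
def TwoConnected {V : Type} (G : SimpleGraph V) : Prop :=
  3 ≤ Nat.card V ∧ ∀ v : V, (G.induce {x | x ≠ v}).Connected

/-- The cell completion of `G`: add an edge `vw` for every pair of (nonadjacent)
vertices `v, w` such that deleting `v` and `w` leaves at least three connected
components. -/
def cellCompletion {V : Type} (G : SimpleGraph V) : SimpleGraph V :=
  SimpleGraph.fromRel (fun v w => G.Adj v w ∨
    3 ≤ Nat.card ((G.induce {x | x ≠ v ∧ x ≠ w}).ConnectedComponent))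

/-- The induced subgraph of `G` on `S` has no cut vertex. -/
def NoCutVertex {V : Type} (G : SimpleGraph V) (S : Set V) : Prop :=
  ∀ v ∈ S, (S \ {v}).Nonempty → (G.induce (S \ {v})).Connected

/-- `S` carries a block of `G`: a maximal connected (induced) subgraph without a
cut vertex. -/
def IsBlock {V : Type} (G : SimpleGraph V) (S : Set V) : Prop :=
  S.Nonempty ∧ (G.induce S).Connected ∧ NoCutVertex G S ∧
    ∀ S' : Set V, S ⊆ S' → (G.induce S').Connected → NoCutVertex G S' → S' = S

/-- Glue a cycle of length `n` onto the graph `G` by identifying the cycle edge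
`{0, 1}` (with its end vertices) with the edge `{a, b}` of `G`. -/
def glueCycle {V : Type} (G : SimpleGraph V) (n : ℕ) (a b : V) :
    SimpleGraph (V ⊕ {x : ZMod n // x ≠ 0 ∧ x ≠ 1}) :=
  SimpleGraph.fromRel (fun p q =>
    match p, q with
    | Sum.inl u, Sum.inl v => G.Adj u v
    | Sum.inl u, Sum.inr x => (u = a ∧ (cycGraph n).Adj 0 x.1) ∨ (u = b ∧ (cycGraph n).Adj 1 x.1)
    | Sum.inr x, Sum.inr y => (cycGraph n).Adj x.1 y.1
    | Sum.inr _, Sum.inl _ => False)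

/-- The class of trees of cycles: every cycle is a tree of cycles, and gluing a
cycle onto a tree of cycles along an edge yields a tree of cycles (up to
isomorphism). -/
inductive IsTreeOfCycles : {V : Type} → SimpleGraph V → Prop
  | cycle {V : Type} (G : SimpleGraph V) (n : ℕ) (hn : 3 ≤ n)
      (e : Nonempty (G ≃g cycGraph n)) : IsTreeOfCycles G
  | glue {V W : Type} (G : SimpleGraph V) (hG : IsTreeOfCycles G)
      (n : ℕ) (hn : 3 ≤ n) (a b : V) (hab : G.Adj a b)
      (H : SimpleGraph W) (e : Nonempty (H ≃g glueCycle G n a b)) : IsTreeOfCycles H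

/-- `S` is the vertex set of a chordless cycle of `G`, i.e. it induces a cycle. -/
def IsChordlessCycle {V : Type} (G : SimpleGraph V) (S : Set V) : Prop :=
  ∃ n : ℕ, 3 ≤ n ∧ Nonempty ((G.induce S) ≃g cycGraph n)

/-- The edge `uv` is an edge separator: it lies in at least two distinct chordless
cycles of `G`. -/
def IsEdgeSeparator {V : Type} (G : SimpleGraph V) (u v : V) : Prop :=
  G.Adj u v ∧ ∃ S₁ S₂ : Set V, S₁ ≠ S₂ ∧ IsChordlessCycle G S₁ ∧ IsChordlessCycle G S₂ ∧
    u ∈ S₁ ∧ v ∈ S₁ ∧ u ∈ S₂ ∧ v ∈ S₂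

/-- `S` is a simplicial triangle of `G`: a chordless cycle on three vertices
containing a simplicial vertex of `G`. -/
def IsSimplicialTriangle {V : Type} (G : SimpleGraph V) (S : Set V) : Prop :=
  IsChordlessCycle G S ∧ S.ncard = 3 ∧ ∃ v ∈ S, G.IsClique (G.neighborSet v)

/-- A chain tree of cycles: a tree of cycles in which every edge lies in at most two
chordless cycles that are not simplicial triangles (equivalently, if an edge lies in
`m ≥ 3` chordless cycles then at least `m - 2` of them are simplicial triangles). -/
def IsChainTreeOfCycles {V : Type} (G : SimpleGraph V) : Prop :=
  IsTreeOfCycles G ∧ ∀ u v : V, G.Adj u v →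
    {S : Set V | IsChordlessCycle G S ∧ u ∈ S ∧ v ∈ S ∧ ¬ IsSimplicialTriangle G S}.ncard ≤ 2

/-- A tree of two-boundaried cycles: a tree of cycles in which every chordless
cycle contains at most two edge separators. -/
def IsTreeOfTwoBoundariedCycles {V : Type} (G : SimpleGraph V) : Prop :=
  IsTreeOfCycles G ∧ ∀ S : Set V, IsChordlessCycle G S →
    {e : Sym2 V | ∃ u v : V, e = s(u, v) ∧ u ∈ S ∧ v ∈ S ∧ IsEdgeSeparator G u v}.ncard ≤ 2

/-- A path of cycles: a tree of cycles in which every chordless cycle contains at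
most two edge separators and every edge lies in at most two chordless cycles that
are not simplicial triangles. -/
def IsPathOfCycles {V : Type} (G : SimpleGraph V) : Prop :=
  IsTreeOfCycles G ∧
    (∀ S : Set V, IsChordlessCycle G S →
      {e : Sym2 V | ∃ u v : V, e = s(u, v) ∧ u ∈ S ∧ v ∈ S ∧ IsEdgeSeparator G u v}.ncard ≤ 2) ∧
    ∀ u v : V, G.Adj u v →
      {S : Set V | IsChordlessCycle G S ∧ u ∈ S ∧ v ∈ S ∧ ¬ IsSimplicialTriangle G S}.ncard ≤ 2

/-- The graph is a single edge. -/
def IsSingleEdgeGraph {V : Type} (G : SimpleGraph V) : Prop :=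
  Nat.card V = 2 ∧ ∀ a b : V, a ≠ b → G.Adj a b

/-- A mamba: a 2-connected graph of pathwidth two, a single edge, or an isolated
vertex. -/
def IsMamba {V : Type} (G : SimpleGraph V) : Prop :=
  (TwoConnected G ∧ pw G = 2) ∨ IsSingleEdgeGraph G ∨ Nat.card V = 1

/-- `v` is a head vertex of the mamba `G`: some path decomposition of `G` of width
at most two has `v` in its first bag. -/
def IsHeadVertex {V : Type} (G : SimpleGraph V) (v : V) : Prop :=
  ∃ pd : PathDecomp G, (∀ i, (pd.bag i).ncard ≤ 3) ∧ v ∈ pd.bag ⟨0, pd.hm⟩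

/-- Glue the graph `M` onto the graph `G` by identifying the vertex `h` of `M` with
the vertex `x` of `G`. -/
def glueAtVertex {V W : Type} (G : SimpleGraph V) (x : V) (M : SimpleGraph W) (h : W) :
    SimpleGraph (V ⊕ {w : W // w ≠ h}) :=
  SimpleGraph.fromRel (fun p q =>
    match p, q with
    | Sum.inl u, Sum.inl u' => G.Adj u u'
    | Sum.inl u, Sum.inr w => u = x ∧ M.Adj h w.1
    | Sum.inr w, Sum.inr w' => M.Adj w.1 w'.1
    | Sum.inr _, Sum.inl _ => False)

/-- The class of mamba trees: every mamba is a mamba tree, and gluing a mamba onto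
a mamba tree by identifying a vertex of the mamba tree with a head vertex of the
mamba yields a mamba tree (up to isomorphism). -/
inductive IsMambaTree : {V : Type} → SimpleGraph V → Prop
  | mamba {V : Type} (G : SimpleGraph V) (hG : IsMamba G) : IsMambaTree G
  | glue {V W U : Type} (G : SimpleGraph V) (hG : IsMambaTree G)
      (M : SimpleGraph W) (hM : IsMamba M) (x : V) (h : W) (hh : IsHeadVertex M h)
      (K : SimpleGraph U) (e : Nonempty (K ≃g glueAtVertex G x M h)) : IsMambaTree K

/-- Subdivide the edge `{a, b}` of `G` by a new vertex. -/
def subdivideEdge {V : Type} (G : SimpleGraph V) (a b : V) : SimpleGraph (V ⊕ Unit) :=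
  SimpleGraph.fromRel (fun p q =>
    match p, q with
    | Sum.inl u, Sum.inl v => G.Adj u v ∧ ¬(u = a ∧ v = b) ∧ ¬(u = b ∧ v = a)
    | Sum.inl u, Sum.inr _ => u = a ∨ u = b
    | Sum.inr _, _ => False)

/-- `H` is a subdivision of `G`: `H` is obtained from (an isomorphic copy of) `G`
by repeatedly subdividing edges. -/
inductive IsSubdivisionOf : {W V : Type} → SimpleGraph W → SimpleGraph V → Prop
  | base {V W : Type} {G : SimpleGraph V} {H : SimpleGraph W}
      (e : Nonempty (H ≃g G)) : IsSubdivisionOf H G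
  | step {V W U : Type} {G : SimpleGraph V} {H : SimpleGraph W} (a b : W) (hab : H.Adj a b)
      (h : IsSubdivisionOf H G) {K : SimpleGraph U}
      (e : Nonempty (K ≃g subdivideEdge H a b)) : IsSubdivisionOf K G

/-- Contract the edge `{a, b}` of `G` (the contracted vertex is `a`, `b` is removed). -/
def contractEdge {V : Type} (G : SimpleGraph V) (a b : V) : SimpleGraph {x : V // x ≠ b} :=
  SimpleGraph.fromRel (fun x y =>
    G.Adj x.1 y.1 ∨ (x.1 = a ∧ G.Adj b y.1) ∨ (y.1 = a ∧ G.Adj b x.1))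

/-- `S` induces a connected subgraph of `G`, phrased through adjacency-closed subsets. -/
def SetConn {V : Type} (G : SimpleGraph V) (S : Set V) : Prop :=
  S.Nonempty ∧ ∀ D ⊆ S, D.Nonempty → (∀ a ∈ D, ∀ b ∈ S, G.Adj a b → b ∈ D) → S ⊆ D

theorem SetConn.of_connected {V : Type} {G : SimpleGraph V} {S : Set V}
    (h : (G.induce S).Connected) : SetConn G S := by
  obtain ⟨⟨s, hs⟩⟩ := h.nonempty
  refine ⟨⟨s, hs⟩, fun D hDS ⟨d, hd⟩ hcl b hb => ?_⟩
  obtain ⟨p⟩ := h.preconnected ⟨d, hDS hd⟩ ⟨b, hb⟩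
  have key : ∀ {x y : S}, (G.induce S).Walk x y → (x : V) ∈ D → (y : V) ∈ D := by
    intro x y p
    induction p with
    | nil => exact id
    | @cons u v w e p ih => exact fun hu => ih (hcl _ hu _ v.2 e)
  exact key p hd

theorem SetConn.connected {V : Type} {G : SimpleGraph V} {S : Set V}
    (h : SetConn G S) : (G.induce S).Connected := by
  obtain ⟨⟨s, hs⟩, h⟩ := h
  have key : ∀ x : S, (G.induce S).Reachable ⟨s, hs⟩ x := by
    intro x
    have hx := h {b | ∃ hb : b ∈ S, (G.induce S).Reachable ⟨s, hs⟩ ⟨b, hb⟩} (fun b hb => hb.1)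
      ⟨s, hs, Reachable.refl _⟩
      (by
        rintro a ⟨ha, hr⟩ b hb hab
        exact ⟨hb, hr.trans (Adj.reachable (G := G.induce S) (u := ⟨a, ha⟩) (v := ⟨b, hb⟩) hab)⟩)
      x.2
    exact hx.2
  have : Nonempty S := ⟨⟨s, hs⟩⟩
  exact ⟨fun x y => (key x).symm.trans (key y)⟩

theorem setConn_iff_connected {V : Type} {G : SimpleGraph V} {S : Set V} :
    SetConn G S ↔ (G.induce S).Connected :=
  ⟨SetConn.connected, SetConn.of_connected⟩

theorem setConn_univ_iff {V : Type} {G : SimpleGraph V} :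
    SetConn G Set.univ ↔ G.Connected := by
  rw [setConn_iff_connected, (SimpleGraph.induceUnivIso G).connected_iff]

theorem setConn_induce_iff {V : Type} {G : SimpleGraph V} {B : Set V} {S : Set B} :
    SetConn (G.induce B) S ↔ SetConn G (Subtype.val '' S) := by
  constructor
  · rintro ⟨hne, h⟩
    refine ⟨hne.image _, fun D hD hDne hcl => ?_⟩
    rintro _ ⟨b, hb, rfl⟩
    refine h (Subtype.val ⁻¹' D) ?_ ?_ ?_ hb
    · intro a ha
      obtain ⟨a', ha', e⟩ := hD ha
      rwa [← Subtype.ext e]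
    · obtain ⟨d, hd⟩ := hDne
      obtain ⟨a', ha', rfl⟩ := hD hd
      exact ⟨a', hd⟩
    · exact fun a ha b hb hab => hcl _ ha _ ⟨b, hb, rfl⟩ hab
  · rintro ⟨hne, h⟩
    refine ⟨hne.of_image, fun D hD hDne hcl b hb => ?_⟩
    obtain ⟨a, ha, e⟩ := h (Subtype.val '' D) (Set.image_mono hD) (hDne.image _)
      (by
        rintro _ ⟨a, ha, rfl⟩ _ ⟨b, hb, rfl⟩ hab
        exact ⟨b, hcl a ha b hb hab, rfl⟩) ⟨b, hb, rfl⟩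
    rwa [← Subtype.ext e]

/-- `S` is a vertical path of the rooted tree given by the functions `parent` and `depth`. -/
def IsVertical {ι : Type} (parent : ι → ι) (depth : ι → ℕ) (S : Set ι) : Prop :=
  (∀ x ∈ S, ∀ y ∈ S, depth x = depth y → x = y) ∧
    ∀ x ∈ S, ∀ y ∈ S, depth y < depth x → parent x ∈ S

/-- A special tree decomposition with bags of size at most `k`, whose rooted tree is given by
a parent function and a depth function. -/
structure RootedDecomp {V : Type} (G : SimpleGraph V) (k : ℕ) where
  ι : Type
  fin : Finite ι
  root : ι
  parent : ι → ι
  depth : ι → ℕ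
  depth_root : depth root = 0
  depth_parent : ∀ x, x ≠ root → depth (parent x) + 1 = depth x
  bag : ι → Set V
  cover : ∀ v : V, ∃ x, v ∈ bag x
  edge : ∀ ⦃u v : V⦄, G.Adj u v → ∃ x, u ∈ bag x ∧ v ∈ bag x
  vertical : ∀ v : V, IsVertical parent depth {x | v ∈ bag x}
  card_le : ∀ x, (bag x).encard ≤ k

namespace RootedDecomp

variable {V : Type} {G : SimpleGraph V} {k : ℕ}

/-- Pull a decomposition back along an injective homomorphism. -/
def comap {W : Type} {H : SimpleGraph W} (td : RootedDecomp G k) (f : H →g G)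
    (hf : Function.Injective f) : RootedDecomp H k where
  ι := td.ι
  fin := td.fin
  root := td.root
  parent := td.parent
  depth := td.depth
  depth_root := td.depth_root
  depth_parent := td.depth_parent
  bag x := f ⁻¹' td.bag x
  cover v := td.cover (f v)
  edge _ _ h := td.edge (f.map_adj h)
  vertical v := td.vertical (f v)
  card_le x := le_trans (Set.encard_le_encard_of_injOn (f := f) (fun _ h => h) hf.injOn)
    (td.card_le x)

/-- `z` is a (not necessarily proper) descendant of `y`. -/
def Desc (td : RootedDecomp G k) (z y : td.ι) : Prop :=
  Relation.ReflTransGen (fun a b => a ≠ td.root ∧ td.parent a = b) z y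

theorem Desc.depth_le {td : RootedDecomp G k} {z y : td.ι} (h : td.Desc z y) :
    td.depth y ≤ td.depth z := by
  induction h using Relation.ReflTransGen.head_induction_on with
  | refl => exact le_rfl
  | head h _ ih => have := td.depth_parent _ h.1; rw [h.2] at this; omega

theorem Desc.eq_of_depth_le {td : RootedDecomp G k} {z y : td.ι} (h : td.Desc z y)
    (hd : td.depth z ≤ td.depth y) : z = y := by
  rcases Relation.ReflTransGen.cases_head h with h | ⟨c, hc, h⟩
  · exact h
  · have := td.depth_parent _ hc.1
    have h' : td.Desc c y := h
    have := h'.depth_le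
    rw [hc.2] at *
    omega

theorem eq_root_of_depth (td : RootedDecomp G k) {x : td.ι} (h : td.depth x = 0) :
    x = td.root := by
  by_contra hx
  have := td.depth_parent x hx
  omega

theorem ne_root_of_depth_lt (td : RootedDecomp G k) {x y : td.ι} (h : td.depth y < td.depth x) :
    x ≠ td.root := by
  rintro rfl
  have := td.depth_root
  omega

theorem desc_parent_of_desc (td : RootedDecomp G k) {x y : td.ι} (h : td.Desc x y) (hxy : x ≠ y) :
    x ≠ td.root ∧ td.Desc (td.parent x) y := by
  rcases Relation.ReflTransGen.cases_head h with h | ⟨c, ⟨hc, rfl⟩, h⟩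
  · exact absurd h hxy
  · exact ⟨hc, h⟩

theorem desc_of_vertical (td : RootedDecomp G k) {S : Set td.ι}
    (hS : IsVertical td.parent td.depth S) {x y : td.ι} (hx : x ∈ S) (hy : y ∈ S)
    (h : td.depth y ≤ td.depth x) : td.Desc x y := by
  induction hn : td.depth x generalizing x with
  | zero => rw [hS.1 x hx y hy (by omega)]; exact Relation.ReflTransGen.refl
  | succ n ih =>
    rcases h.eq_or_lt with h | h
    · rw [hS.1 x hx y hy h.symm]; exact Relation.ReflTransGen.refl
    · have hr := td.ne_root_of_depth_lt h
      have hd := td.depth_parent x hr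
      exact Relation.ReflTransGen.head ⟨hr, rfl⟩
        (ih (hS.2 x hx y hy h) (by omega) (by omega))

theorem vertical_cross (td : RootedDecomp G k) {S : Set td.ι}
    (hS : IsVertical td.parent td.depth S) {y a b : td.ι} (ha : a ∈ S) (hb : b ∈ S)
    (hay : td.Desc a y) (hby : ¬ td.Desc b y) : y ∈ S ∧ td.parent y ∈ S := by
  induction hn : td.depth a using Nat.strong_induction_on generalizing a with
  | _ n ih =>
    have hba : td.depth b < td.depth a := by
      by_contra hlt
      exact hby ((td.desc_of_vertical hS hb ha (by omega)).trans hay)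
    by_cases h : a = y
    · subst h
      exact ⟨ha, hS.2 a ha b hb hba⟩
    · obtain ⟨hr, hd⟩ := td.desc_parent_of_desc hay h
      have := td.depth_parent a hr
      exact ih _ (by omega) (hS.2 a ha b hb hba) hd rfl

theorem adhesion (td : RootedDecomp G k) {y : td.ι} {S : Set V} (hS : SetConn G S)
    {s s' : V} (hs : s ∈ S) (hs' : s' ∈ S) {a b : td.ι} (ha : td.Desc a y) (hsa : s ∈ td.bag a)
    (hb : ¬ td.Desc b y) (hsb : s' ∈ td.bag b) :
    ∃ r ∈ S, r ∈ td.bag y ∧ r ∈ td.bag (td.parent y) := by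
  by_contra hcon
  push Not at hcon
  have key : ∀ r ∈ S, ∀ a b, td.Desc a y → ¬ td.Desc b y → r ∈ td.bag a → r ∈ td.bag b → False :=
    fun r hr a b ha hb hra hrb =>
      have := td.vertical_cross (td.vertical r) (a := a) (b := b) hra hrb ha hb
      hcon r hr this.1 this.2
  have := hS.2 {r | r ∈ S ∧ ∃ a, td.Desc a y ∧ r ∈ td.bag a} (fun r hr => hr.1)
    ⟨s, hs, a, ha, hsa⟩ (by
      rintro r ⟨hr, a, ha, hra⟩ r' hr' hrr'
      obtain ⟨z, hz, hz'⟩ := td.edge hrr'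
      by_cases hzy : td.Desc z y
      · exact ⟨hr', z, hzy, hz'⟩
      · exact (key r hr a z ha hzy hra hz).elim) hs'
  obtain ⟨_, a', ha', hsa'⟩ := this
  exact key s' hs' a' b ha' hb hsa' hsb

/-- The nodes whose bags contain at least two elements of `B`. -/
def core (td : RootedDecomp G k) (B : Set V) : Set td.ι :=
  {x | ∃ a ∈ B, ∃ b ∈ B, a ≠ b ∧ a ∈ td.bag x ∧ b ∈ td.bag x}

theorem exists_ne_of_mem_core {td : RootedDecomp G k} {B : Set V} {x : td.ι} (hx : x ∈ td.core B)
    (r : V) : ∃ a ∈ B, a ≠ r ∧ a ∈ td.bag x := by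
  obtain ⟨a, ha, b, hb, hab, hax, hbx⟩ := hx
  by_cases h : a = r
  · exact ⟨b, hb, fun h' => hab (h.trans h'.symm), hbx⟩
  · exact ⟨a, ha, h, hax⟩

end RootedDecomp

/-- `B` induces a connected subgraph that stays connected after deleting any one vertex. -/
def Unsplittable {V : Type} (G : SimpleGraph V) (B : Set V) : Prop :=
  SetConn G B ∧ ∀ s : V, SetConn G (B \ {s})

namespace RootedDecomp

variable {V : Type} {G : SimpleGraph V} {k : ℕ}

theorem adhesion_two (td : RootedDecomp G k) {B : Set V} (hB : Unsplittable G B) {x x' y : td.ι}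
    (hx : x ∈ td.core B) (hx' : x' ∈ td.core B) (hxy : td.Desc x y) (hx'y : ¬ td.Desc x' y) :
    ∃ a ∈ B, ∃ b ∈ B, a ≠ b ∧ (a ∈ td.bag y ∧ b ∈ td.bag y) ∧
      a ∈ td.bag (td.parent y) ∧ b ∈ td.bag (td.parent y) := by
  have key : ∀ r : V, ∃ a ∈ B \ {r}, a ∈ td.bag y ∧ a ∈ td.bag (td.parent y) := by
    intro r
    obtain ⟨a, ha, har, hax⟩ := exists_ne_of_mem_core hx r
    obtain ⟨b, hb, hbr, hbx⟩ := exists_ne_of_mem_core hx' r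
    exact td.adhesion (hB.2 r) ⟨ha, har⟩ ⟨hb, hbr⟩ hxy hax hx'y hbx
  obtain ⟨s, -⟩ := hx
  obtain ⟨a, ⟨ha, -⟩, ha1, ha2⟩ := key s
  obtain ⟨b, ⟨hb, hba⟩, hb1, hb2⟩ := key a
  exact ⟨a, ha, b, hb, fun h => hba h.symm, ⟨ha1, hb1⟩, ha2, hb2⟩

theorem core_adhesion (td : RootedDecomp G k) {B : Set V} (hB : Unsplittable G B) {x x' : td.ι}
    (hx : x ∈ td.core B) (hx' : x' ∈ td.core B) (hne : x' ≠ x) (hd : td.depth x' ≤ td.depth x) :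
    ∃ a ∈ B, ∃ b ∈ B, a ≠ b ∧ (a ∈ td.bag x ∧ b ∈ td.bag x) ∧
      a ∈ td.bag (td.parent x) ∧ b ∈ td.bag (td.parent x) :=
  td.adhesion_two hB hx hx' Relation.ReflTransGen.refl
    (fun h => hne (Desc.eq_of_depth_le h hd))

theorem core_parent (td : RootedDecomp G k) {B : Set V} (hB : Unsplittable G B) {x x' : td.ι}
    (hx : x ∈ td.core B) (hx' : x' ∈ td.core B) (hne : x' ≠ x) (hd : td.depth x' ≤ td.depth x) :
    td.parent x ∈ td.core B := by
  obtain ⟨a, ha, b, hb, hab, -, h⟩ := td.core_adhesion hB hx hx' hne hd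
  exact ⟨a, ha, b, hb, hab, h⟩

end RootedDecomp

theorem false_of_four_mem {α : Type} {s : Set α} (hs : s.encard ≤ (3 : ℕ)) {a b c d : α}
    (ha : a ∈ s) (hb : b ∈ s) (hc : c ∈ s) (hd : d ∈ s) (hab : a ≠ b) (hac : a ≠ c) (had : a ≠ d)
    (hbc : b ≠ c) (hbd : b ≠ d) (hcd : c ≠ d) : False := by
  have h1 : ({a, b, c, d} : Set α) ⊆ s := by
    rintro x (rfl | rfl | rfl | rfl) <;> assumption
  have h2 := (Set.encard_le_encard h1).trans hs
  rw [Set.encard_insert_of_notMem (by simp [*]), Set.encard_insert_of_notMem (by simp [*]),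
    Set.encard_insert_of_notMem (by simp [*]), Set.encard_singleton] at h2
  exact absurd h2 (by decide)

namespace RootedDecomp

variable {V : Type} {G : SimpleGraph V}

theorem core_vertical (td : RootedDecomp G 3) {B : Set V} (hB : Unsplittable G B) :
    IsVertical td.parent td.depth (td.core B) := by
  refine ⟨?_, fun x hx y hy h => td.core_parent hB hx hy (by rintro rfl; omega) h.le⟩
  intro x hx y hy h
  induction hn : td.depth x generalizing x y with
  | zero => exact (td.eq_root_of_depth hn).trans (td.eq_root_of_depth (h.symm.trans hn)).symm
  | succ n ih =>
    by_contra hne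
    have hxr : x ≠ td.root := td.ne_root_of_depth_lt (y := td.root) (by rw [td.depth_root]; omega)
    have hyr : y ≠ td.root := td.ne_root_of_depth_lt (y := td.root) (by rw [td.depth_root]; omega)
    have h1 := td.depth_parent x hxr
    have h2 := td.depth_parent y hyr
    have hp := ih _ (td.core_parent hB hx hy (Ne.symm hne) h.ge) _
      (td.core_parent hB hy hx hne h.le) (by omega) (by omega)
    obtain ⟨a, -, b, -, hab, ⟨ha, hb⟩, ha', hb'⟩ := td.core_adhesion hB hx hy (Ne.symm hne) h.ge
    obtain ⟨c, -, d, -, hcd, ⟨hc, hd⟩, hc', hd'⟩ := td.core_adhesion hB hy hx hne h.le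
    rw [← hp] at hc' hd'
    have key : ∀ u v, u ∈ td.bag x → v ∈ td.bag y → u ≠ v := by
      rintro u _ hu hv rfl
      exact hne ((td.vertical u).1 x hu y hv h)
    exact false_of_four_mem (td.card_le _) ha' hb' hc' hd' hab (key _ _ ha hc) (key _ _ ha hd)
      (key _ _ hb hc) (key _ _ hb hd) hcd

end RootedDecomp

theorem SetConn.exists_adj {V : Type} {G : SimpleGraph V} {S : Set V} (h : SetConn G S) {a b : V}
    (ha : a ∈ S) (hb : b ∈ S) (hab : a ≠ b) : ∃ c ∈ S, G.Adj a c := by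
  by_contra hcon
  push Not at hcon
  have := h.2 {a} (by simpa using ha) ⟨a, rfl⟩ (by
    rintro _ rfl c hc hac
    exact (hcon c hc hac).elim) hb
  exact hab this.symm

theorem Unsplittable.exists_ne {V : Type} {G : SimpleGraph V} {B : Set V} (hB : Unsplittable G B)
    (a : V) : ∃ b ∈ B, a ≠ b := by
  obtain ⟨b, hb, hba⟩ := (hB.2 a).1
  exact ⟨b, hb, fun h => hba h.symm⟩

theorem Unsplittable.induce {V : Type} {G : SimpleGraph V} {B : Set V} (hB : Unsplittable G B) :
    Unsplittable (G.induce B) Set.univ := by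
  refine ⟨?_, fun s => ?_⟩
  · rw [setConn_induce_iff]
    simpa using hB.1
  · rw [setConn_induce_iff]
    convert hB.2 s using 1
    ext x
    simp [and_comm]

namespace RootedDecomp

variable {V : Type} {G : SimpleGraph V} {k : ℕ}

theorem exists_mem_core (td : RootedDecomp G k) {B : Set V} (hB : Unsplittable G B) {a : V}
    (ha : a ∈ B) : ∃ x ∈ td.core B, a ∈ td.bag x := by
  obtain ⟨b, hb, hab⟩ := hB.exists_ne a
  obtain ⟨c, hc, hac⟩ := hB.1.exists_adj ha hb hab
  obtain ⟨x, hx, hx'⟩ := td.edge hac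
  exact ⟨x, ⟨a, ha, c, hc, hac.ne, hx, hx'⟩, hx⟩

theorem exists_core_top (td : RootedDecomp G k) {B : Set V} (hB : Unsplittable G B) :
    ∃ t ∈ td.core B, ∀ x ∈ td.core B, td.depth t ≤ td.depth x := by
  have := td.fin
  obtain ⟨b, hb⟩ := hB.1.1
  obtain ⟨x, hx, -⟩ := td.exists_mem_core hB hb
  exact Set.exists_min_image (td.core B) td.depth (Set.toFinite _) ⟨x, hx⟩

theorem isHeadVertex (td : RootedDecomp G 3) {B : Set V} (hB : Unsplittable G B) {t : td.ι}
    (ht : t ∈ td.core B) (hmin : ∀ x ∈ td.core B, td.depth t ≤ td.depth x) {v : V} (hv : v ∈ B)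
    (hvt : v ∈ td.bag t) : IsHeadVertex (G.induce B) ⟨v, hv⟩ := by
  have := td.fin
  have hvert := td.core_vertical hB
  obtain ⟨D, hD⟩ := (Set.finite_range td.depth).bddAbove
  have hD : ∀ x, td.depth x ≤ D := fun x => hD ⟨x, rfl⟩
  refine ⟨{ m := D + 1
            hm := Nat.succ_pos _
            bag := fun i => {b | ∃ x ∈ td.core B, td.depth x = td.depth t + i ∧ b.1 ∈ td.bag x}
            bag_cover := ?_
            bag_edge := ?_
            bag_convex := ?_ }, fun i => ?_, ⟨t, ht, rfl, hvt⟩⟩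
  · rintro ⟨b, hb⟩
    obtain ⟨x, hx, hbx⟩ := td.exists_mem_core hB hb
    have h1 := hmin x hx
    have h2 := hD x
    exact ⟨⟨td.depth x - td.depth t, by omega⟩, x, hx, by simp; omega, hbx⟩
  · rintro ⟨a, ha⟩ ⟨b, hb⟩ hab
    have hab : G.Adj a b := hab
    obtain ⟨x, hax, hbx⟩ := td.edge hab
    have hx : x ∈ td.core B := ⟨a, ha, b, hb, hab.ne, hax, hbx⟩
    have h1 := hmin x hx
    have h2 := hD x
    exact ⟨⟨td.depth x - td.depth t, by omega⟩, ⟨x, hx, by simp; omega, hax⟩,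
      ⟨x, hx, by simp; omega, hbx⟩⟩
  · rintro ⟨b, hb⟩ ⟨i, hi⟩ ⟨j, hj⟩ ⟨l, hl⟩ hij hjl ⟨x, hx, hxi, hbx⟩ ⟨y, hy, hyl, hby⟩
    simp only [Fin.mk_le_mk] at hij hjl
    simp only [Set.mem_ofPred_eq] at hxi hbx hyl hby ⊢
    clear hl
    induction l, hjl using Nat.le_induction generalizing y with
    | base => exact ⟨y, hy, hyl, hby⟩
    | succ l hjl ih =>
      have hlt : td.depth x < td.depth y := by omega
      have := td.depth_parent y (td.ne_root_of_depth_lt hlt)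
      exact ih _ (hvert.2 y hy x hx hlt) (by omega) ((td.vertical b).2 y hby x hbx hlt)
  · by_cases h : ∃ x ∈ td.core B, td.depth x = td.depth t + i
    · obtain ⟨x, hx, hxi⟩ := h
      refine (Set.encard_le_coe_iff_finite_ncard_le.1
        ((Set.encard_le_encard_of_injOn (f := Subtype.val) ?_ Subtype.val_injective.injOn).trans
          (td.card_le x))).2
      rintro b ⟨y, hy, hyi, hby⟩
      rwa [hvert.1 x hx y hy (by omega)]
    · have hemp : {b : B | ∃ x ∈ td.core B, td.depth x = td.depth t + i ∧ b.1 ∈ td.bag x} = ∅ :=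
        Set.eq_empty_of_forall_notMem fun b ⟨y, hy, hyi, _⟩ => h ⟨y, hy, hyi⟩
      have := Set.ncard_empty B
      rw [← hemp] at this
      exact this.le.trans (Nat.zero_le 3)

/-- A path decomposition seen as a special tree decomposition rooted at its first bag. -/
def ofPathDecomp (pd : PathDecomp G) (hk : ∀ i, (pd.bag i).encard ≤ k) : RootedDecomp G k where
  ι := Fin pd.m
  fin := inferInstance
  root := ⟨0, pd.hm⟩
  parent i := ⟨i - 1, by omega⟩
  depth i := i
  depth_root := rfl
  depth_parent := by
    rintro ⟨i, hi⟩ h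
    simp only [ne_eq, Fin.mk.injEq] at h ⊢
    omega
  bag := pd.bag
  cover := pd.bag_cover
  edge := pd.bag_edge
  vertical v := by
    refine ⟨fun x _ y _ h => Fin.ext h, fun x hx y hy h => ?_⟩
    have h : y.val < x.val := h
    refine pd.bag_convex v y _ x ?_ ?_ hy hx
    · rw [Fin.le_def]; simp only; omega
    · rw [Fin.le_def]; simp only; omega
  card_le := hk

theorem bag_subset_of_core (td : RootedDecomp G 2) {B : Set V} (hB : Unsplittable G B) {t x : td.ι}
    (ht : t ∈ td.core B) (hmin : ∀ x ∈ td.core B, td.depth t ≤ td.depth x) (hx : x ∈ td.core B) :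
    td.bag x ⊆ td.bag t := by
  induction hn : td.depth x using Nat.strong_induction_on generalizing x with
  | _ n ih =>
    by_cases h : t = x
    · rw [h]
    obtain ⟨a, ha, b, hb, hab, ⟨hax, hbx⟩, hap, hbp⟩ := td.core_adhesion hB hx ht h (hmin x hx)
    have hr : x ≠ td.root := by
      rintro rfl
      have h1 := hmin _ hx
      rw [td.depth_root] at h1
      exact h (td.eq_root_of_depth (by omega))
    have hd := td.depth_parent x hr
    refine subset_trans ?_ (ih _ (by omega) (td.core_parent hB hx ht h (hmin x hx)) rfl)
    intro c hc
    by_contra hcp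
    have h1 : ({c, a, b} : Set V) ⊆ td.bag x := by
      rintro y (rfl | rfl | rfl) <;> assumption
    have h2 := (Set.encard_le_encard h1).trans (td.card_le x)
    have hca : c ≠ a := by rintro rfl; exact hcp hap
    have hcb : c ≠ b := by rintro rfl; exact hcp hbp
    rw [Set.encard_eq_three.2 ⟨c, a, b, hca, hcb, hab, rfl⟩] at h2
    exact absurd h2 (by decide)

end RootedDecomp

theorem two_le_pw {W : Type} {H : SimpleGraph W} [Finite W] (h : Unsplittable H Set.univ)
    (hc : 3 ≤ Nat.card W) : 2 ≤ pw H := by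
  by_contra hlt
  have hne : {k | ∃ pd : PathDecomp H, ∀ i, (pd.bag i).ncard ≤ k + 1}.Nonempty :=
    ⟨Nat.card W, ⟨1, one_pos, fun _ => Set.univ, fun _ => ⟨0, trivial⟩,
      fun _ _ _ => ⟨0, trivial, trivial⟩, fun _ _ _ _ _ _ _ _ => trivial⟩, fun i => by
      simp [Set.ncard_univ]⟩
  obtain ⟨pd, hpd⟩ := Nat.sInf_mem hne
  change ∀ i, (pd.bag i).ncard ≤ pw H + 1 at hpd
  let td : RootedDecomp H 2 := .ofPathDecomp pd fun i =>
    Set.encard_le_coe_iff_finite_ncard_le.2 ⟨Set.toFinite _, (hpd i).trans (by omega)⟩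
  obtain ⟨t, ht, hmin⟩ := td.exists_core_top h
  have huniv : Set.univ ⊆ td.bag t := by
    intro v _
    obtain ⟨x, hx, hvx⟩ := td.exists_mem_core h (Set.mem_univ v)
    exact td.bag_subset_of_core h ht hmin hx hvx
  have h1 := (Set.encard_le_coe_iff_finite_ncard_le.1 (td.card_le t)).2
  rw [Set.univ_subset_iff.1 huniv, Set.ncard_univ] at h1
  omega

theorem isMamba_induce {V : Type} [Finite V] {G : SimpleGraph V} {B : Set V}
    (hB : Unsplittable G B) {v : B} (hv : IsHeadVertex (G.induce B) v) : IsMamba (G.induce B) := by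
  have h2 : 2 ≤ Nat.card B := by
    obtain ⟨b, hb, hvb⟩ := hB.exists_ne v
    rw [← Nat.lt_iff_add_one_le, Finite.one_lt_card_iff_nontrivial]
    exact ⟨v, ⟨b, hb⟩, fun h => hvb (congrArg Subtype.val h)⟩
  rcases h2.eq_or_lt with h2 | h3
  · refine Or.inr (Or.inl ⟨h2.symm, fun a b hab => ?_⟩)
    obtain ⟨c, -, hac⟩ := hB.induce.1.exists_adj (Set.mem_univ a) (Set.mem_univ b) hab
    have hbc : b = c := by
      by_contra hbc
      have : ({a, b, c} : Set B).ncard = 3 := Set.ncard_eq_three.2 ⟨a, b, c, hab, hac.ne, hbc, rfl⟩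
      have := Set.ncard_le_card ({a, b, c} : Set B)
      omega
    rwa [hbc]
  · refine Or.inl ⟨⟨h3, fun s => ?_⟩, le_antisymm ?_ (two_le_pw hB.induce h3)⟩
    · rw [← setConn_iff_connected]
      convert hB.induce.2 s using 1
      ext x
      simp
    · obtain ⟨pd, hpd, -⟩ := hv
      exact Nat.sInf_le ⟨pd, hpd⟩

section Glue

variable {V W : Type} {G : SimpleGraph V} {x : V} {M : SimpleGraph W} {h : W}

theorem glueAtVertex_adj_inl_inl {a b : V} :
    (glueAtVertex G x M h).Adj (Sum.inl a) (Sum.inl b) ↔ G.Adj a b := by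
  simp only [glueAtVertex, fromRel_adj, G.adj_comm b a, or_self, ne_eq, Sum.inl.injEq]
  exact ⟨And.right, fun h => ⟨h.ne, h⟩⟩

theorem glueAtVertex_adj_inl_inr {a : V} {w : {w : W // w ≠ h}} :
    (glueAtVertex G x M h).Adj (Sum.inl a) (Sum.inr w) ↔ a = x ∧ M.Adj h w.1 := by
  simp [glueAtVertex]

theorem glueAtVertex_adj_inr_inl {a : V} {w : {w : W // w ≠ h}} :
    (glueAtVertex G x M h).Adj (Sum.inr w) (Sum.inl a) ↔ a = x ∧ M.Adj h w.1 := by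
  simp [glueAtVertex]

theorem glueAtVertex_adj_inr_inr {w w' : {w : W // w ≠ h}} :
    (glueAtVertex G x M h).Adj (Sum.inr w) (Sum.inr w') ↔ M.Adj w.1 w'.1 := by
  simp only [glueAtVertex, fromRel_adj, M.adj_comm w'.1 w.1, or_self, ne_eq, Sum.inr.injEq]
  exact ⟨And.right, fun h => ⟨fun h' => h.ne (congrArg _ h'), h⟩⟩

end Glue

theorem isMambaTree_of_glue {V : Type} {G : SimpleGraph V} {v : V} {C : Set V}
    (hv : v ∉ C) (hN : ∀ a ∈ C, ∀ b, G.Adj a b → b ∈ C ∨ b = v)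
    (hM : IsMamba (G.induce (insert v C)))
    (hh : IsHeadVertex (G.induce (insert v C)) ⟨v, Set.mem_insert _ _⟩)
    (hR : IsMambaTree (G.induce Cᶜ)) : IsMambaTree G := by
  have key : ∀ w : {w : (insert v C : Set V) // w ≠ ⟨v, Set.mem_insert _ _⟩}, w.1.1 ∈ C :=
    fun w => w.1.2.resolve_left fun h => w.2 (Subtype.ext h)
  refine IsMambaTree.glue _ hR _ hM ⟨v, hv⟩ _ hh G ⟨RelIso.symm ⟨Equiv.ofBijective
    (Sum.elim Subtype.val fun w => w.1.1) ⟨?_, ?_⟩, ?_⟩⟩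
  · rintro (a | a) (b | b) h
    · exact congrArg Sum.inl (Subtype.ext h)
    · have h : a.1 = b.1.1 := h
      exact absurd (h ▸ key b) a.2
    · have h : a.1.1 = b.1 := h
      exact absurd (h ▸ key a) b.2
    · exact congrArg Sum.inr (Subtype.ext (Subtype.ext h))
  · intro x
    by_cases hx : x ∈ C
    · exact ⟨Sum.inr ⟨⟨x, Or.inr hx⟩, fun h => hv ((show x = v from congrArg Subtype.val h) ▸ hx)⟩, rfl⟩
    · exact ⟨Sum.inl ⟨x, hx⟩, rfl⟩
  · rintro (a | a) (b | b)
    · rw [glueAtVertex_adj_inl_inl]; rfl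
    · rw [glueAtVertex_adj_inl_inr]
      change G.Adj a.1 b.1.1 ↔ a = _ ∧ G.Adj v b.1.1
      refine ⟨fun h => ?_, fun h => by rw [h.1] at *; exact h.2⟩
      have e := (hN _ (key b) _ h.symm).resolve_left a.2
      exact ⟨Subtype.ext e, e ▸ h⟩
    · rw [glueAtVertex_adj_inr_inl]
      change G.Adj a.1.1 b.1 ↔ b = _ ∧ G.Adj v a.1.1
      refine ⟨fun h => ?_, fun h => by rw [h.1] at *; exact h.2.symm⟩
      have e := (hN _ (key a) _ h).resolve_left b.2
      exact ⟨Subtype.ext e, e ▸ h.symm⟩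
    · rw [glueAtVertex_adj_inr_inr]; rfl

/-- `C` is a nonempty union of components of `G - v` that misses some vertex other than `v`. -/
structure IsLobe {V : Type} (G : SimpleGraph V) (v : V) (C : Set V) : Prop where
  notMem : v ∉ C
  nonempty : C.Nonempty
  closed : ∀ a ∈ C, ∀ b, G.Adj a b → b ∈ C ∨ b = v
  proper : ∃ w, w ∉ C ∧ w ≠ v

theorem exists_split_of_not_setConn {V : Type} {G : SimpleGraph V} {S : Set V} (hS : S.Nonempty)
    (h : ¬ SetConn G S) : ∃ D E : Set V, D.Nonempty ∧ E.Nonempty ∧ D ∪ E = S ∧ Disjoint D E ∧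
      ∀ a ∈ D, ∀ b ∈ E, ¬ G.Adj a b := by
  simp only [SetConn, hS, true_and, not_forall] at h
  obtain ⟨D, hD, hne, hcl, hSD⟩ := h
  exact ⟨D, S \ D, hne, Set.sdiff_nonempty.2 hSD, Set.union_sdiff_cancel hD,
    Set.disjoint_sdiff_right, fun a ha b hb hab => hb.2 (hcl a ha b hb.1 hab)⟩

namespace IsLobe

variable {V : Type} {G : SimpleGraph V} {v : V} {C : Set V}

theorem exists_adj (h : IsLobe G v C) (hG : SetConn G Set.univ) : ∃ c ∈ C, G.Adj c v := by
  by_contra hcon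
  push Not at hcon
  exact h.notMem (hG.2 C (Set.subset_univ _) h.nonempty (fun a ha b _ hab =>
    (h.closed a ha b hab).resolve_right (by rintro rfl; exact hcon a ha hab)) (Set.mem_univ v))

theorem setConn_compl (h : IsLobe G v C) (hG : SetConn G Set.univ) : SetConn G Cᶜ := by
  refine ⟨⟨v, h.notMem⟩, fun D hD hne hcl => ?_⟩
  by_cases hv : v ∈ D
  · intro x hx
    refine (hG.2 (D ∪ C) (Set.subset_univ _) (hne.mono Set.subset_union_left) ?_
      (Set.mem_univ x)).resolve_right hx
    rintro a (ha | ha) b - hab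
    · by_cases hb : b ∈ C
      · exact Or.inr hb
      · exact Or.inl (hcl a ha b hb hab)
    · rcases h.closed a ha b hab with hb | rfl
      · exact Or.inr hb
      · exact Or.inl hv
  · refine absurd (hG.2 D (Set.subset_univ _) hne (fun a ha b _ hab => ?_) (Set.mem_univ v)) hv
    refine hcl a ha b (fun hb => ?_) hab
    rcases h.closed b hb a hab.symm with ha' | rfl
    · exact hD ha ha'
    · exact hv ha

theorem setConn_insert (h : IsLobe G v C) (hG : SetConn G Set.univ) :
    SetConn G (insert v C) := by
  refine ⟨⟨v, Set.mem_insert _ _⟩, fun D hD hne hcl => ?_⟩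
  by_cases hv : v ∈ D
  · intro x hx
    by_contra hxD
    have := hG.2 (D ∪ Cᶜ) (Set.subset_univ _) (hne.mono Set.subset_union_left) (by
      rintro a ha b - hab
      by_cases hb : b ∈ C
      · refine Or.inl (hcl a ?_ b (Or.inr hb) hab)
        rcases ha with ha | ha
        · exact ha
        · rw [(h.closed b hb a hab.symm).resolve_left ha]
          exact hv
      · exact Or.inr hb) (Set.mem_univ x)
    rcases this with h1 | h1
    · exact hxD h1
    · exact (hx.resolve_right h1 ▸ hxD) hv
  · refine absurd (hG.2 D (Set.subset_univ _) hne (fun a ha b _ hab => ?_) (Set.mem_univ v)) hv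
    refine hcl a ha b ?_ hab
    rcases hD ha with rfl | haC
    · exact absurd ha hv
    · exact (h.closed a haC b hab).symm

theorem of_split (h : IsLobe G v C) {s : V} {D E : Set V}
    (hD : D.Nonempty) (hE : E.Nonempty) (hDE : D ∪ E = insert v C \ {s}) (hdis : Disjoint D E)
    (hadj : ∀ a ∈ D, ∀ b ∈ E, ¬ G.Adj a b) (hv : v ∉ D) : D ⊆ C ∧ IsLobe G s D := by
  have hDC : D ⊆ C := fun x hx => by
    have : x ∈ insert v C \ {s} := hDE ▸ Or.inl hx
    exact this.1.resolve_left (by rintro rfl; exact hv hx)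
  refine ⟨hDC, fun hs => ?_, hD, fun a ha b hab => ?_, ?_⟩
  · have : s ∈ insert v C \ {s} := hDE ▸ Or.inl hs
    exact this.2 rfl
  · by_cases hb : b = s
    · exact Or.inr hb
    · have : b ∈ insert v C \ {s} := ⟨(h.closed a (hDC ha) b hab).symm, hb⟩
      rw [← hDE] at this
      exact Or.inl (this.resolve_right fun hbE => hadj a ha b hbE hab)
  · obtain ⟨e, he⟩ := hE
    have : e ∈ insert v C \ {s} := hDE ▸ Or.inr he
    exact ⟨e, fun heD => Set.disjoint_left.1 hdis heD he, this.2⟩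

theorem exists_smaller (h : IsLobe G v C) (hG : SetConn G Set.univ)
    (hB : ¬ Unsplittable G (insert v C)) : ∃ u D, D ⊂ C ∧ IsLobe G u D := by
  have hs : ∃ s, ¬ SetConn G (insert v C \ {s}) := by
    by_contra hcon
    push Not at hcon
    exact hB ⟨h.setConn_insert hG, hcon⟩
  obtain ⟨s, hs⟩ := hs
  have hsB : s ∈ insert v C := by
    by_contra hsB
    rw [Set.sdiff_singleton_eq_self hsB] at hs
    exact hs (h.setConn_insert hG)
  have hne : (insert v C \ {s}).Nonempty := by
    by_cases hsv : s = v
    · obtain ⟨c, hc⟩ := h.nonempty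
      exact ⟨c, Or.inr hc, by rintro rfl; exact h.notMem (hsv ▸ hc)⟩
    · exact ⟨v, Or.inl rfl, fun h => hsv h.symm⟩
  have key : ∀ D E : Set V, D.Nonempty → E.Nonempty → D ∪ E = insert v C \ {s} → Disjoint D E →
      (∀ a ∈ D, ∀ b ∈ E, ¬ G.Adj a b) → v ∉ D → ∃ u D, D ⊂ C ∧ IsLobe G u D := by
    intro D E hD hE hDE hdis hadj hv
    obtain ⟨hDC, hl⟩ := h.of_split hD hE hDE hdis hadj hv
    refine ⟨s, D, ⟨hDC, fun hCD => ?_⟩, hl⟩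
    rcases hsB with rfl | hsC
    · obtain ⟨e, he⟩ := hE
      have : e ∈ insert s C \ {s} := hDE ▸ Or.inr he
      exact Set.disjoint_left.1 hdis (hCD (this.1.resolve_left this.2)) he
    · exact hl.notMem (hCD hsC)
  obtain ⟨D, E, hD, hE, hDE, hdis, hadj⟩ := exists_split_of_not_setConn hne hs
  by_cases hv : v ∈ D
  · exact key E D hE hD (by rw [Set.union_comm, hDE]) hdis.symm
      (fun a ha b hb hab => hadj b hb a ha hab.symm) (Set.disjoint_left.1 hdis hv)
  · exact key D E hD hE hDE hdis hadj hv

theorem exists_unsplittable [Finite V] (h : IsLobe G v C) (hG : SetConn G Set.univ) :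
    ∃ u D, D ⊆ C ∧ IsLobe G u D ∧ Unsplittable G (insert u D) := by
  induction hn : C.ncard using Nat.strong_induction_on generalizing v C with
  | _ n ih =>
    by_cases hB : Unsplittable G (insert v C)
    · exact ⟨v, C, subset_rfl, h, hB⟩
    · obtain ⟨u, D, hDC, hl⟩ := h.exists_smaller hG hB
      obtain ⟨u', D', hD', hl'⟩ := ih _ (hn ▸ Set.ncard_lt_ncard hDC (Set.toFinite _)) hl rfl
      exact ⟨u', D', hD'.trans hDC.subset, hl'⟩

/-- The attachment vertex of a lobe lies in its highest core bag as soon as something else lives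
at least as high. -/
theorem mem_bag_top (h : IsLobe G v C) (hG : SetConn G Set.univ) (td : RootedDecomp G 3)
    (hB : Unsplittable G (insert v C)) {t : td.ι} (ht : t ∈ td.core (insert v C))
    (hmin : ∀ x ∈ td.core (insert v C), td.depth t ≤ td.depth x) {z : td.ι} {w : V}
    (hz : td.depth z ≤ td.depth t) (hw : w ∉ C) (hwz : w ∈ td.bag z) : v ∈ td.bag t := by
  by_contra hvt
  have := td.fin
  obtain ⟨x₀, hx₀, hvx₀⟩ := td.exists_mem_core hB (Set.mem_insert v C)
  obtain ⟨y, ⟨hy, hvy⟩, hymin⟩ := Set.exists_min_image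
    {x | x ∈ td.core (insert v C) ∧ v ∈ td.bag x} td.depth (Set.toFinite _) ⟨x₀, hx₀, hvx₀⟩
  have hty : t ≠ y := by rintro rfl; exact hvt hvy
  have hlt : td.depth t < td.depth y := lt_of_le_of_ne (hmin y hy) fun he =>
    hty ((td.core_vertical hB).1 t ht y hy he)
  obtain ⟨a, ha, b, hb, hab, ⟨hay, hby⟩, hap, hbp⟩ := td.core_adhesion hB hy ht hty hlt.le
  have hp := td.depth_parent y (td.ne_root_of_depth_lt hlt)
  have hvp : v ∉ td.bag (td.parent y) := fun hv => by
    have := hymin _ ⟨td.core_parent hB hy ht hty hlt.le, hv⟩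
    omega
  have hzy : ¬ td.Desc z y := fun hd => by
    have := hd.depth_le
    omega
  obtain ⟨r, hr, hry, hrp⟩ := td.adhesion (h.setConn_compl hG) h.notMem hw
    Relation.ReflTransGen.refl hvy hzy hwz
  have hva : v ≠ a := by rintro rfl; exact hvp hap
  have hvb : v ≠ b := by rintro rfl; exact hvp hbp
  have hvr : v ≠ r := by rintro rfl; exact hvp hrp
  exact false_of_four_mem (td.card_le y) hvy hay hby hry hva hvb hvr hab
    (by rintro rfl; exact hr (ha.resolve_left hva.symm))
    (by rintro rfl; exact hr (hb.resolve_left hvb.symm))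

end IsLobe

theorem isMambaTree_of_rootedDecomp (n : ℕ) : ∀ {V : Type} [Finite V] {G : SimpleGraph V},
    Nat.card V = n → SetConn G Set.univ → RootedDecomp G 3 → IsMambaTree G := by
  induction n using Nat.strong_induction_on with
  | _ n ih =>
  intro V _ G hn hG td
  obtain ⟨v₀, -⟩ := hG.1
  have hpos : 0 < Nat.card V := Nat.card_pos_iff.2 ⟨⟨v₀⟩, inferInstance⟩
  rcases (Nat.succ_le_of_lt hpos).eq_or_lt with h1 | h1
  · exact IsMambaTree.mamba G (Or.inr (Or.inr h1.symm))
  by_cases hU : Unsplittable G Set.univ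
  · obtain ⟨t, ht, hmin⟩ := td.exists_core_top hU
    obtain ⟨v, -, -, -, -, hvt, -⟩ := id ht
    have hins : insert v ({v}ᶜ : Set V) = Set.univ := by ext x; simp [em]
    rw [← hins] at hU ht hmin
    have hh := td.isHeadVertex hU ht hmin (Set.mem_insert v _) hvt
    refine isMambaTree_of_glue (by simp) (fun a _ b _ => by simp [em']) (isMamba_induce hU hh) hh
      (IsMambaTree.mamba _ (Or.inr (Or.inr ?_)))
    rw [compl_compl]
    exact Nat.card_unique
  · have hs : ∃ s, ¬ SetConn G (Set.univ \ {s}) := by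
      by_contra hcon
      push Not at hcon
      exact hU ⟨hG, hcon⟩
    obtain ⟨s, hs⟩ := hs
    have hne : (Set.univ \ {s}).Nonempty := by
      have := Finite.one_lt_card_iff_nontrivial.1 h1
      obtain ⟨y, hy⟩ := exists_ne s
      exact ⟨y, trivial, hy⟩
    obtain ⟨D, E, hD, hE, hDE, hdis, hadj⟩ := exists_split_of_not_setConn hne hs
    have mkLobe : ∀ D E : Set V, D.Nonempty → E.Nonempty → D ∪ E = Set.univ \ {s} →
        Disjoint D E → (∀ a ∈ D, ∀ b ∈ E, ¬ G.Adj a b) → IsLobe G s D := by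
      intro D E hD hE hDE hdis hadj
      have hmem : ∀ x, x ∈ D ∪ E ↔ x ≠ s := fun x => by rw [hDE]; simp
      refine ⟨fun h => (hmem s).1 (Or.inl h) rfl, hD, fun a ha b hab => ?_, ?_⟩
      · by_cases hb : b = s
        · exact Or.inr hb
        · exact Or.inl (((hmem b).2 hb).resolve_right fun hbE => hadj a ha b hbE hab)
      · obtain ⟨e, he⟩ := hE
        exact ⟨e, fun heD => Set.disjoint_left.1 hdis heD he, (hmem e).1 (Or.inr he)⟩
    have lD := mkLobe D E hD hE hDE hdis hadj
    have lE := mkLobe E D hE hD (by rw [Set.union_comm, hDE]) hdis.symm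
      (fun a ha b hb hab => hadj b hb a ha hab.symm)
    obtain ⟨v₁, C₁, hC₁, l₁, hB₁⟩ := lD.exists_unsplittable hG
    obtain ⟨v₂, C₂, hC₂, l₂, hB₂⟩ := lE.exists_unsplittable hG
    have attach : ∀ {D E : Set V} {u C C'}, IsLobe G s D → IsLobe G s E → Disjoint D E →
        IsLobe G u C → C ⊆ D → C' ⊆ E → u ∉ C' := by
      intro D E u C C' lD lE hdis l hC hC' hu
      obtain ⟨c, hc, hcu⟩ := l.exists_adj hG
      rcases lD.closed c (hC hc) u hcu with h | rfl
      · exact Set.disjoint_left.1 hdis h (hC' hu)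
      · exact lE.notMem (hC' hu)
    obtain ⟨t₁, ht₁, hmin₁⟩ := td.exists_core_top hB₁
    obtain ⟨t₂, ht₂, hmin₂⟩ := td.exists_core_top hB₂
    have step : ∀ {v C v' C'} {t t' : td.ι}, IsLobe G v C → Unsplittable G (insert v C) →
        t ∈ td.core (insert v C) → (∀ x ∈ td.core (insert v C), td.depth t ≤ td.depth x) →
        t' ∈ td.core (insert v' C') → td.depth t' ≤ td.depth t → v' ∉ C → Disjoint C C' →
        IsMambaTree G := by
      intro v C v' C' t t' l hB ht hmin ht' hle hv' hdis
      obtain ⟨w, hw, -, -, -, hwt, -⟩ := ht'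
      have hwC : w ∉ C := by
        rcases hw with rfl | hw
        · exact hv'
        · exact fun h => Set.disjoint_left.1 hdis h hw
      have hh := td.isHeadVertex hB ht hmin (Set.mem_insert v C)
        (l.mem_bag_top hG td hB ht hmin hle hwC hwt)
      refine isMambaTree_of_glue l.notMem l.closed (isMamba_induce hB hh) hh ?_
      refine ih _ ?_ rfl (setConn_univ_iff.2 (l.setConn_compl hG).connected)
        (td.comap (Embedding.induce _).toHom Subtype.val_injective)
      obtain ⟨c, hc⟩ := l.nonempty
      rw [← hn]
      exact Finite.card_subtype_lt (x := c) (fun h => h hc)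
    have hdis' : Disjoint C₁ C₂ := hdis.mono hC₁ hC₂
    rcases le_total (td.depth t₂) (td.depth t₁) with hle | hle
    · exact step l₁ hB₁ ht₁ hmin₁ ht₂ hle (attach lE lD hdis.symm l₂ hC₂ hC₁) hdis'
    · exact step l₂ hB₂ ht₂ hmin₂ ht₁ hle (attach lD lE hdis l₁ hC₁ hC₂) hdis'.symm

theorem exists_adj_dist_add_one {ι : Type} {T : SimpleGraph ι} (hT : T.Connected) {x r : ι}
    (h : x ≠ r) : ∃ y, T.Adj x y ∧ T.dist y r + 1 = T.dist x r := by
  obtain ⟨p, hp⟩ := hT.exists_walk_length_eq_dist x r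
  cases p with
  | nil => exact absurd rfl h
  | @cons _ y _ e q =>
    refine ⟨y, e, ?_⟩
    have h1 := dist_le q
    have h2 := hT.dist_triangle (u := x) (v := y) (w := r)
    rw [dist_eq_one_iff_adj.2 e] at h2
    rw [Walk.length_cons] at hp
    omega

theorem eq_of_adj_dist_add_one {ι : Type} {T : SimpleGraph ι} (hT : T.IsTree) {x y z r : ι}
    (hy : T.Adj x y) (hyd : T.dist y r + 1 = T.dist x r)
    (hz : T.Adj x z) (hzd : T.dist z r + 1 = T.dist x r) : y = z := by
  obtain ⟨p, hp⟩ := hT.connected.exists_walk_length_eq_dist y r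
  obtain ⟨q, hq⟩ := hT.connected.exists_walk_length_eq_dist z r
  have h1 : (Walk.cons hy p).IsPath := Walk.isPath_of_length_eq_dist _ (by simp [hp, hyd])
  have h2 : (Walk.cons hz q).IsPath := Walk.isPath_of_length_eq_dist _ (by simp [hq, hzd])
  have h := (hT.existsUnique_path x r).unique h1 h2
  simpa using congrArg Walk.snd h

theorem dist_ne_of_adj {ι : Type} {T : SimpleGraph ι} (hT : T.IsTree) {x y : ι} (r : ι)
    (h : T.Adj x y) : T.dist x r ≠ T.dist y r := by
  classical
  intro hd
  obtain ⟨p, hp⟩ := hT.connected.exists_walk_length_eq_dist x r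
  obtain ⟨q, hq⟩ := hT.connected.exists_walk_length_eq_dist y r
  have hy : y ∉ p.support := by
    intro hy
    have h1 := dist_le (p.dropUntil y hy)
    have h2 := congrArg Walk.length (p.take_spec hy)
    rw [Walk.length_append] at h2
    exact h.ne (Walk.eq_of_length_eq_zero (p := p.takeUntil y hy) (by omega))
  have h1 : (Walk.cons h.symm p).IsPath :=
    (Walk.cons_isPath_iff _ _).2 ⟨Walk.isPath_of_length_eq_dist _ hp, hy⟩
  have h2 := (hT.existsUnique_path y r).unique h1 (Walk.isPath_of_length_eq_dist _ hq)
  have h3 := congrArg Walk.length h2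
  rw [Walk.length_cons] at h3
  omega

theorem dist_add_one_or_of_adj {ι : Type} {T : SimpleGraph ι} (hT : T.IsTree) {x y : ι} (r : ι)
    (h : T.Adj x y) : T.dist x r + 1 = T.dist y r ∨ T.dist y r + 1 = T.dist x r := by
  have h1 := hT.connected.dist_triangle (u := x) (v := y) (w := r)
  have h2 := hT.connected.dist_triangle (u := y) (v := x) (w := r)
  rw [dist_eq_one_iff_adj.2 h] at h1
  rw [dist_eq_one_iff_adj.2 h.symm] at h2
  have := dist_ne_of_adj hT r h
  omega

/-- In a tree with root `r`, a directed path is vertical with respect to the parent function. -/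
theorem isVertical_of_isDirPathSet {ι : Type} [Finite ι] {T : SimpleGraph ι} (hT : T.IsTree)
    {r : ι} {parent : ι → ι} (hadj : ∀ x, x ≠ r → T.Adj x (parent x))
    (hdist : ∀ x, x ≠ r → T.dist (parent x) r + 1 = T.dist x r) {S : Set ι}
    (hS : IsDirPathSet T (fun x y => T.Adj x y ∧ T.dist y r < T.dist x r) S) :
    IsVertical parent (fun x => T.dist x r) S := by
  have hconn := SetConn.of_connected hS.1.1
  have hroot : ∀ {x y}, T.dist y r < T.dist x r → x ≠ r := by
    rintro x y h rfl
    simp at h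
  have hparent : ∀ {x y}, T.Adj x y → T.dist y r < T.dist x r → y = parent x := by
    intro x y h hd
    have hx := hroot hd
    have := dist_add_one_or_of_adj hT r h
    exact eq_of_adj_dist_add_one hT h (by omega) (hadj x hx) (hdist x hx)
  have htop : ∀ x ∈ S, parent x ∉ S → ∀ y ∈ S,
      Relation.ReflTransGen (fun a b => T.dist b r < T.dist a r ∧ parent a = b) y x := by
    intro x hx hp y hy
    refine (hconn.2 {z | z ∈ S ∧
      Relation.ReflTransGen (fun a b => T.dist b r < T.dist a r ∧ parent a = b) z x}
      (fun z hz => hz.1) ⟨x, hx, .refl⟩ ?_ hy).2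
    rintro a ⟨ha, hax⟩ b hb hab
    refine ⟨hb, ?_⟩
    rcases lt_or_ge (T.dist b r) (T.dist a r) with h | h
    · obtain rfl := hparent hab h
      rcases Relation.ReflTransGen.cases_head hax with rfl | ⟨c, ⟨-, rfl⟩, h'⟩
      · exact absurd hb hp
      · exact h'
    · have h := lt_of_le_of_ne h (dist_ne_of_adj hT r hab)
      exact .head ⟨h, (hparent hab.symm h).symm⟩ hax
  have hle : ∀ {y x}, Relation.ReflTransGen
      (fun a b => T.dist b r < T.dist a r ∧ parent a = b) y x →
      y = x ∨ T.dist x r < T.dist y r := by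
    intro y x h
    induction h with
    | refl => exact Or.inl rfl
    | tail _ h ih => rcases ih with rfl | ih <;> [exact Or.inr h.1; exact Or.inr (h.1.trans ih)]
  refine ⟨fun x hx y hy hd => ?_, fun x hx y hy hd => ?_⟩
  · induction hn : T.dist x r using Nat.strong_induction_on generalizing x y with
    | _ n ih =>
      by_contra hxy
      have hd : T.dist x r = T.dist y r := hd
      have hpx : parent x ∈ S := by
        by_contra hp
        rcases hle (htop x hx hp y hy) with h | h
        · exact hxy h.symm
        · omega
      have hpy : parent y ∈ S := by
        by_contra hp
        rcases hle (htop y hy hp x hx) with h | h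
        · exact hxy h
        · omega
      have hxr : x ≠ r := by
        rintro rfl
        rw [dist_self, eq_comm, hT.connected.dist_eq_zero_iff] at hd
        exact hxy hd.symm
      have hyr : y ≠ r := by
        rintro rfl
        rw [dist_self, hT.connected.dist_eq_zero_iff] at hd
        exact hxy hd
      have h1 := hdist x hxr
      have h2 := hdist y hyr
      have hpp := ih (T.dist (parent x) r) (by omega) _ hpx _ hpy
        (show T.dist (parent x) r = T.dist (parent y) r by omega) rfl
      refine hxy ((Set.ncard_le_one (Set.toFinite _)).1 (hS.2.2 _ hpx) x ⟨hx, ?_, ?_⟩ y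
        ⟨hy, ?_, ?_⟩)
      · exact hadj x hxr
      · omega
      · rw [hpp]; exact hadj y hyr
      · omega
  · by_contra hp
    have hd : T.dist y r < T.dist x r := hd
    rcases hle (htop x hx hp y hy) with rfl | h <;> omega

theorem SpecialTD.nonempty_rootedDecomp {V : Type} [Finite V] {G : SimpleGraph V} {k : ℕ}
    (td : SpecialTD G) (hk : ∀ x, (td.bag x).ncard ≤ k) : Nonempty (RootedDecomp G k) := by
  classical
  have := td.finι
  choose! parent hadj hdist using fun x (h : x ≠ td.root) =>
    exists_adj_dist_add_one td.isTree.connected h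
  exact ⟨{
    ι := td.ι
    fin := td.finι
    root := td.root
    parent := parent
    depth x := td.tree.dist x td.root
    depth_root := dist_self
    depth_parent := hdist
    bag := td.bag
    cover := td.bag_cover
    edge := td.bag_edge
    vertical v := isVertical_of_isDirPathSet td.isTree hadj hdist (td.bag_vertical v)
    card_le x := Set.encard_le_coe_iff_finite_ncard_le.2 ⟨Set.toFinite _, hk x⟩ }⟩

namespace RootedDecomp

variable {V : Type} {G : SimpleGraph V} {k : ℕ} (td : RootedDecomp G k)

/-- The tree underlying a decomposition, as a graph. -/
def tree : SimpleGraph td.ι :=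
  SimpleGraph.fromRel (fun x y => x ≠ td.root ∧ td.parent x = y)

variable {td} in
theorem tree_adj_parent {x : td.ι} (hx : x ≠ td.root) : td.tree.Adj x (td.parent x) := by
  refine (SimpleGraph.fromRel_adj _ _ _).2 ⟨fun h => ?_, Or.inl ⟨hx, rfl⟩⟩
  have := td.depth_parent x hx
  rw [← h] at this
  omega

variable {td} in
theorem tree_adj_cases {x y : td.ι} (h : td.tree.Adj x y) :
    (td.parent x = y ∧ td.depth y + 1 = td.depth x) ∨
      (td.parent y = x ∧ td.depth x + 1 = td.depth y) := by
  rcases ((SimpleGraph.fromRel_adj _ _ _).1 h).2 with ⟨hr, rfl⟩ | ⟨hr, rfl⟩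
  · exact Or.inl ⟨rfl, td.depth_parent _ hr⟩
  · exact Or.inr ⟨rfl, td.depth_parent _ hr⟩

theorem exists_walk_root (x : td.ι) : ∃ p : td.tree.Walk x td.root, p.length = td.depth x := by
  induction hn : td.depth x generalizing x with
  | zero =>
    obtain rfl := td.eq_root_of_depth hn
    exact ⟨.nil, rfl⟩
  | succ n ih =>
    have hx : x ≠ td.root := by
      rintro rfl
      rw [td.depth_root] at hn
      omega
    have := td.depth_parent x hx
    obtain ⟨p, hp⟩ := ih (td.parent x) (by omega)
    exact ⟨.cons (tree_adj_parent hx) p, by rw [Walk.length_cons, hp]⟩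

theorem tree_connected : td.tree.Connected := by
  have : Nonempty td.ι := ⟨td.root⟩
  refine ⟨fun x y => ?_⟩
  obtain ⟨p, -⟩ := td.exists_walk_root x
  obtain ⟨q, -⟩ := td.exists_walk_root y
  exact ⟨p.append q.reverse⟩

theorem tree_isTree : td.tree.IsTree := by
  have := td.fin
  refine isTree_iff_connected_and_card.2 ⟨td.tree_connected,
    le_antisymm ?_ td.tree_connected.card_vert_le_card_edgeSet_add_one⟩
  have h1 : td.tree.edgeSet ⊆ (fun x => s(x, td.parent x)) '' {td.root}ᶜ := by
    intro e
    induction e with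
    | _ x y =>
      intro h
      have h : td.tree.Adj x y := h
      have hroot : ∀ {x y : td.ι}, td.depth y + 1 = td.depth x → x ∈ ({td.root}ᶜ : Set td.ι) := by
        rintro x y h rfl
        rw [td.depth_root] at h
        omega
      rcases tree_adj_cases h with ⟨rfl, hd⟩ | ⟨rfl, hd⟩
      · exact ⟨x, hroot hd, rfl⟩
      · exact ⟨y, hroot hd, Sym2.eq_swap⟩
  have h2 := (Set.ncard_le_ncard h1).trans (Set.ncard_image_le (Set.toFinite _))
  have h3 := Set.ncard_add_ncard_compl {td.root}
  rw [Set.ncard_singleton] at h3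
  rw [Nat.card_coe_set_eq]
  omega

theorem tree_dist_root (x : td.ι) : td.tree.dist x td.root = td.depth x := by
  obtain ⟨p, hp⟩ := td.exists_walk_root x
  refine le_antisymm (hp ▸ dist_le p) ?_
  obtain ⟨q, hq⟩ := td.tree_connected.exists_walk_length_eq_dist x td.root
  rw [← hq]
  have key : ∀ {a b : td.ι} (q : td.tree.Walk a b), td.depth a ≤ td.depth b + q.length := by
    intro a b q
    induction q with
    | nil => simp
    | cons h q ih =>
      rw [Walk.length_cons]
      rcases tree_adj_cases h with ⟨-, h⟩ | ⟨-, h⟩ <;> omega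
  simpa [td.depth_root] using key q

theorem setConn_of_isVertical {S : Set td.ι} (hne : S.Nonempty)
    (hS : IsVertical td.parent td.depth S) : SetConn td.tree S := by
  refine ⟨hne, fun D hDS hD hcl => ?_⟩
  obtain ⟨d, hd, hmin⟩ : ∃ d ∈ D, ∀ y ∈ D, td.depth d ≤ td.depth y := by
    obtain ⟨d, hd, hmin⟩ := (measure td.depth).wf.has_min D hD
    exact ⟨d, hd, fun y hy => not_lt.1 (hmin y hy)⟩
  have htop : ∀ y ∈ S, td.depth d ≤ td.depth y := by
    intro y hy
    by_contra h
    have hr := td.ne_root_of_depth_lt (not_le.1 h)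
    have h1 := hmin _ (hcl d hd _ (hS.2 d (hDS hd) y hy (not_le.1 h)) (tree_adj_parent hr))
    have := td.depth_parent d hr
    omega
  intro y hy
  induction hn : td.depth y using Nat.strong_induction_on generalizing y with
  | _ n ih =>
    rcases (htop y hy).eq_or_lt with h | h
    · rwa [← hS.1 d (hDS hd) y hy h]
    · have hr := td.ne_root_of_depth_lt h
      have := td.depth_parent y hr
      exact hcl _ (ih _ (by omega) (hS.2 y hy d (hDS hd) h) rfl) y hy (tree_adj_parent hr).symm

theorem isDirPathSet_of_isVertical {S : Set td.ι} (hne : S.Nonempty)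
    (hS : IsVertical td.parent td.depth S) :
    IsDirPathSet td.tree (fun x y => td.tree.Adj x y ∧
      td.tree.dist y td.root < td.tree.dist x td.root) S := by
  have := td.fin
  simp only [tree_dist_root]
  have hout : ∀ x ∈ S, {y | y ∈ S ∧ td.tree.Adj x y ∧ td.depth y < td.depth x}.ncard ≤ 1 := by
    intro x _
    refine (Set.ncard_le_one (Set.toFinite _)).2 ?_
    rintro a ⟨-, ha, had⟩ b ⟨-, hb, hbd⟩
    rcases tree_adj_cases ha with ⟨rfl, _⟩ | ⟨-, _⟩
    · rcases tree_adj_cases hb with ⟨rfl, _⟩ | ⟨-, _⟩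
      · rfl
      · omega
    · omega
  have hin : ∀ x ∈ S, {y | y ∈ S ∧ td.tree.Adj y x ∧ td.depth x < td.depth y}.ncard ≤ 1 := by
    intro x _
    refine (Set.ncard_le_one (Set.toFinite _)).2 ?_
    rintro a ⟨haS, ha, had⟩ b ⟨hbS, hb, hbd⟩
    refine hS.1 a haS b hbS ?_
    rcases tree_adj_cases ha with ⟨-, _⟩ | ⟨-, _⟩ <;>
      rcases tree_adj_cases hb with ⟨-, _⟩ | ⟨-, _⟩ <;> omega
  refine ⟨⟨(td.setConn_of_isVertical hne hS).connected, fun x hx => ?_⟩, hout, hin⟩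
  have hsub : {y | y ∈ S ∧ td.tree.Adj x y} ⊆
      {y | y ∈ S ∧ td.tree.Adj x y ∧ td.depth y < td.depth x} ∪
        {y | y ∈ S ∧ td.tree.Adj y x ∧ td.depth x < td.depth y} := by
    rintro y ⟨hy, h⟩
    rcases tree_adj_cases h with ⟨-, hd⟩ | ⟨-, hd⟩
    · exact Or.inl ⟨hy, h, by omega⟩
    · exact Or.inr ⟨hy, h.symm, by omega⟩
  have h1 := (Set.ncard_le_ncard hsub).trans (Set.ncard_union_le _ _)
  have h2 := hout x hx
  have h3 := hin x hx
  omega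

/-- The special tree decomposition given by a parent function. -/
def toSpecialTD : SpecialTD G where
  ι := td.ι
  finι := td.fin
  tree := td.tree
  isTree := td.tree_isTree
  bag := td.bag
  bag_cover := td.cover
  bag_edge := td.edge
  bag_conn v := (td.setConn_of_isVertical (td.cover v) (td.vertical v)).connected
  root := td.root
  bag_vertical v := td.isDirPathSet_of_isVertical (td.cover v) (td.vertical v)

/-- The decomposition with a single bag. -/
def single (hk : (Set.univ : Set V).encard ≤ k) : RootedDecomp G k where
  ι := Unit
  fin := inferInstance
  root := ()
  parent := id
  depth _ := 0
  depth_root := rfl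
  depth_parent _ h := absurd rfl h
  bag _ := Set.univ
  cover _ := ⟨(), trivial⟩
  edge _ _ _ := ⟨(), trivial, trivial⟩
  vertical _ := ⟨fun _ _ _ _ _ => rfl, fun _ _ _ _ _ => trivial⟩
  card_le _ := hk

end RootedDecomp

theorem spctw_le_iff {V : Type} [Finite V] {G : SimpleGraph V} {k : ℕ} :
    spctw G ≤ k ↔ Nonempty (RootedDecomp G (k + 1)) := by
  have hmem : ∀ n, (∃ td : SpecialTD G, ∀ x, (td.bag x).ncard ≤ n + 1) ↔
      Nonempty (RootedDecomp G (n + 1)) := by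
    refine fun n => ⟨fun ⟨td, h⟩ => td.nonempty_rootedDecomp h, fun ⟨td⟩ => ⟨td.toSpecialTD, ?_⟩⟩
    exact fun x => (Set.encard_le_coe_iff_finite_ncard_le.1 (td.card_le x)).2
  unfold spctw
  simp only [hmem]
  refine ⟨fun h => ?_, fun h => Nat.sInf_le h⟩
  have hne : {n | Nonempty (RootedDecomp G (n + 1))}.Nonempty := by
    refine ⟨Nat.card V, ⟨.single (Set.encard_le_coe_iff_finite_ncard_le.2 ⟨Set.toFinite _, ?_⟩)⟩⟩
    rw [Set.ncard_univ]
    omega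
  obtain ⟨td⟩ := Nat.sInf_mem hne
  exact ⟨{ td with
    card_le := fun x => (td.card_le x).trans (by exact_mod_cast Nat.succ_le_succ h) }⟩

theorem IsMamba.finite {V : Type} {G : SimpleGraph V} (h : IsMamba G) : Finite V := by
  rcases h with ⟨⟨h, -⟩, -⟩ | ⟨h, -⟩ | h <;> exact Nat.finite_of_card_ne_zero (by omega)

theorem IsMamba.nonempty_rootedDecomp {V : Type} {G : SimpleGraph V} (h : IsMamba G) :
    Nonempty (RootedDecomp G 3) := by
  have := h.finite
  have hsingle : Nat.card V ≤ 3 → Nonempty (RootedDecomp G 3) := fun hc =>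
    ⟨.single (Set.encard_le_coe_iff_finite_ncard_le.2
      ⟨Set.toFinite _, by rwa [Set.ncard_univ]⟩)⟩
  rcases h with ⟨-, h⟩ | ⟨h, -⟩ | h
  · have hne : {k | ∃ pd : PathDecomp G, ∀ i, (pd.bag i).ncard ≤ k + 1}.Nonempty :=
      Nat.nonempty_of_pos_sInf (by change 0 < pw G; omega)
    obtain ⟨pd, hpd⟩ := Nat.sInf_mem hne
    refine ⟨.ofPathDecomp pd fun i => Set.encard_le_coe_iff_finite_ncard_le.2
      ⟨Set.toFinite _, (hpd i).trans ?_⟩⟩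
    change pw G + 1 ≤ 3
    omega
  · exact hsingle (by omega)
  · exact hsingle (by omega)

namespace RootedDecomp

/-- Hang a path decomposition whose first bag contains `h` below the deepest node `β` whose bag
contains `x`. -/
def glue {V W : Type} {G : SimpleGraph V} {M : SimpleGraph W} {k : ℕ} (td : RootedDecomp G k)
    (pd : PathDecomp M) (hk : ∀ i, (pd.bag i).encard ≤ k) {x : V} {h : W}
    (hh : h ∈ pd.bag ⟨0, pd.hm⟩) {β : td.ι} (hβ : x ∈ td.bag β)
    (hmax : ∀ i, x ∈ td.bag i → td.depth i ≤ td.depth β) :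
    RootedDecomp (glueAtVertex G x M h) k where
  ι := td.ι ⊕ Fin pd.m
  fin := have := td.fin; inferInstance
  root := Sum.inl td.root
  parent := Sum.elim (fun i => Sum.inl (td.parent i))
    (fun j => if j.val = 0 then Sum.inl β else Sum.inr ⟨j - 1, by omega⟩)
  depth := Sum.elim td.depth (fun j => td.depth β + 1 + j)
  depth_root := td.depth_root
  depth_parent := by
    rintro (i | j) hi
    · exact td.depth_parent i fun h => hi (congrArg Sum.inl h)
    · by_cases hj : j.val = 0
      · simp [hj]
      · simp only [Sum.elim_inr, if_neg hj]
        omega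
  bag := Sum.elim (fun i => {p | ∃ u ∈ td.bag i, p = Sum.inl u})
    (fun j => {p | Sum.elim (fun u => u = x ∧ h ∈ pd.bag j) (fun w => w.1 ∈ pd.bag j) p})
  cover := by
    rintro (u | w)
    · obtain ⟨i, hi⟩ := td.cover u
      exact ⟨Sum.inl i, u, hi, rfl⟩
    · obtain ⟨j, hj⟩ := pd.bag_cover w
      exact ⟨Sum.inr j, hj⟩
  edge := by
    have key : ∀ u w, (glueAtVertex G x M h).Adj (Sum.inl u) (Sum.inr w) →
        ∃ j, u = x ∧ h ∈ pd.bag j ∧ w.1 ∈ pd.bag j := by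
      intro u w e
      have e := glueAtVertex_adj_inl_inr.1 e
      obtain ⟨j, h1, h2⟩ := pd.bag_edge e.2
      exact ⟨j, e.1, h1, h2⟩
    rintro (u | w) (u' | w') e
    · obtain ⟨i, h1, h2⟩ := td.edge (glueAtVertex_adj_inl_inl.1 e)
      exact ⟨Sum.inl i, ⟨u, h1, rfl⟩, ⟨u', h2, rfl⟩⟩
    · obtain ⟨j, h1, h2, h3⟩ := key _ _ e
      exact ⟨Sum.inr j, ⟨h1, h2⟩, h3⟩
    · obtain ⟨j, h1, h2, h3⟩ := key _ _ e.symm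
      exact ⟨Sum.inr j, h3, ⟨h1, h2⟩⟩
    · obtain ⟨j, h1, h2⟩ := pd.bag_edge (glueAtVertex_adj_inr_inr.1 e)
      exact ⟨Sum.inr j, h1, h2⟩
  vertical := by
    have hpath : ∀ {v : W} {i j : Fin pd.m}, v ∈ pd.bag i → v ∈ pd.bag j → i < j →
        ∀ hj : j.val - 1 < pd.m, v ∈ pd.bag ⟨j - 1, hj⟩ := by
      intro v i j hi hj hij hj'
      have hij : i.val < j.val := hij
      refine pd.bag_convex v i _ j ?_ ?_ hi hj <;> rw [Fin.le_def] <;> simp only <;> omega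
    rintro (u | w)
    · constructor
      · rintro (i | i) hi (j | j) hj hd
        · obtain ⟨_, hi, ⟨⟩⟩ := hi
          obtain ⟨_, hj, ⟨⟩⟩ := hj
          exact congrArg Sum.inl ((td.vertical u).1 i hi j hj hd)
        · obtain ⟨_, hi, ⟨⟩⟩ := hi
          obtain ⟨rfl, -⟩ := hj
          have := hmax i hi
          simp only [Sum.elim_inl, Sum.elim_inr] at hd
          omega
        · obtain ⟨_, hj, ⟨⟩⟩ := hj
          obtain ⟨rfl, -⟩ := hi
          have := hmax j hj
          simp only [Sum.elim_inl, Sum.elim_inr] at hd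
          omega
        · simp only [Sum.elim_inr] at hd
          exact congrArg Sum.inr (Fin.ext (by omega))
      · rintro (i | i) hi (j | j) hj hd
        · obtain ⟨_, hi, ⟨⟩⟩ := hi
          obtain ⟨_, hj, ⟨⟩⟩ := hj
          exact ⟨u, (td.vertical u).2 i hi j hj hd, rfl⟩
        · obtain ⟨_, hi, ⟨⟩⟩ := hi
          obtain ⟨rfl, -⟩ := hj
          have := hmax i hi
          simp only [Sum.elim_inl, Sum.elim_inr] at hd
          omega
        all_goals
          obtain ⟨rfl, hi⟩ := hi
          by_cases h0 : i.val = 0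
          · simp only [Sum.elim_inr, if_pos h0]
            exact ⟨u, hβ, rfl⟩
          · simp only [Sum.elim_inr, if_neg h0]
            exact ⟨rfl, hpath hh hi (Fin.lt_def.2 (Nat.pos_of_ne_zero h0)) _⟩
    · constructor
      · rintro (i | i) hi (j | j) hj hd
        · obtain ⟨_, _, ⟨⟩⟩ := hi
        · obtain ⟨_, _, ⟨⟩⟩ := hi
        · obtain ⟨_, _, ⟨⟩⟩ := hj
        · simp only [Sum.elim_inr] at hd
          exact congrArg Sum.inr (Fin.ext (by omega))
      · rintro (i | i) hi (j | j) hj hd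
        · obtain ⟨_, _, ⟨⟩⟩ := hi
        · obtain ⟨_, _, ⟨⟩⟩ := hi
        · obtain ⟨_, _, ⟨⟩⟩ := hj
        · simp only [Sum.elim_inr] at hd
          have h0 : i.val ≠ 0 := by omega
          simp only [Sum.elim_inr, if_neg h0]
          exact hpath hj hi (Fin.lt_def.2 (by omega)) _
  card_le := by
    rintro (i | j)
    · refine le_trans (Set.encard_le_encard ?_)
        ((Set.encard_image_le Sum.inl (td.bag i)).trans (td.card_le i))
      rintro _ ⟨u, hu, rfl⟩
      exact ⟨u, hu, rfl⟩
    · refine le_trans (Set.encard_le_encard_of_injOn (f := Sum.elim (fun _ => h) Subtype.val)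
        (t := pd.bag j) ?_ ?_) (hk j)
      · rintro (u | w) hp
        · exact hp.2
        · exact hp
      · rintro (u | w) hp (u' | w') hp' e
        · rw [hp.1, hp'.1]
        · exact absurd e.symm w'.2
        · exact absurd e w.2
        · exact congrArg Sum.inr (Subtype.ext e)

end RootedDecomp

theorem IsMambaTree.nonempty_rootedDecomp {V : Type} {G : SimpleGraph V} (h : IsMambaTree G) :
    Nonempty (RootedDecomp G 3) := by
  induction h with
  | mamba G hG => exact hG.nonempty_rootedDecomp
  | glue G _ M hM x h hh K e ih =>
    obtain ⟨td⟩ := ih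
    obtain ⟨pd, hpd, hh⟩ := hh
    obtain ⟨e⟩ := e
    have := hM.finite
    have := td.fin
    obtain ⟨β, hβ, hmax⟩ := Set.exists_max_image {i | x ∈ td.bag i} td.depth (Set.toFinite _)
      (td.cover x)
    exact ⟨(td.glue pd (fun i => Set.encard_le_coe_iff_finite_ncard_le.2
      ⟨Set.toFinite _, hpd i⟩) hh hβ hmax).comap e.toHom e.injective⟩

namespace RootedDecomp

/-- Join decompositions of the connected components below a new root with an empty bag. -/
noncomputable def ofComponents {V : Type} [Finite V] {G : SimpleGraph V} {k : ℕ}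
    (td : ∀ c : G.ConnectedComponent, RootedDecomp (G.induce c.supp) k) : RootedDecomp G k where
  ι := Option (Σ c, (td c).ι)
  fin := have := fun c => (td c).fin; inferInstance
  root := none
  parent := fun x => x.elim none fun p => open Classical in
    if p.2 = (td p.1).root then none else some ⟨p.1, (td p.1).parent p.2⟩
  depth := fun x => x.elim 0 fun p => (td p.1).depth p.2 + 1
  depth_root := rfl
  depth_parent := by
    rintro (_ | ⟨c, i⟩) h
    · exact absurd rfl h
    · by_cases hi : i = (td c).root
      · simp [hi, (td c).depth_root]
      · simp [hi, (td c).depth_parent i hi]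
  bag := fun x => x.elim ∅ fun p => {v | ∃ h : v ∈ p.1.supp, ⟨v, h⟩ ∈ (td p.1).bag p.2}
  cover v := by
    obtain ⟨i, hi⟩ := (td (G.connectedComponentMk v)).cover ⟨v, rfl⟩
    exact ⟨some ⟨_, i⟩, rfl, hi⟩
  edge u v h := by
    have hv : v ∈ (G.connectedComponentMk u).supp :=
      (ConnectedComponent.connectedComponentMk_eq_of_adj h).symm
    obtain ⟨i, h1, h2⟩ := (td (G.connectedComponentMk u)).edge (u := ⟨u, rfl⟩) (v := ⟨v, hv⟩) h
    exact ⟨some ⟨_, i⟩, ⟨rfl, h1⟩, ⟨hv, h2⟩⟩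
  vertical v := by
    constructor
    · rintro (_ | ⟨c, i⟩) hx (_ | ⟨c', j⟩) hy hd
      · rfl
      · exact hx.elim
      · exact hy.elim
      · obtain ⟨hc, hx⟩ := hx
        obtain ⟨hc', hy⟩ := hy
        obtain rfl : G.connectedComponentMk v = c := hc
        obtain rfl : G.connectedComponentMk v = c' := hc'
        rw [((td _).vertical ⟨v, rfl⟩).1 i hx j hy (Nat.succ_injective hd)]
    · rintro (_ | ⟨c, i⟩) hx (_ | ⟨c', j⟩) hy hd
      · exact hx.elim
      · exact hx.elim
      · exact hy.elim
      · obtain ⟨hc, hx⟩ := hx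
        obtain ⟨hc', hy⟩ := hy
        obtain rfl : G.connectedComponentMk v = c := hc
        obtain rfl : G.connectedComponentMk v = c' := hc'
        have hd := Nat.lt_of_succ_lt_succ hd
        have hr := (td _).ne_root_of_depth_lt hd
        simp only [Option.elim_some, if_neg hr]
        exact ⟨rfl, ((td _).vertical ⟨v, rfl⟩).2 i hx j hy hd⟩
  card_le := by
    rintro (_ | ⟨c, i⟩)
    · simp
    · refine le_trans (Set.encard_le_encard ?_)
        ((Set.encard_image_le Subtype.val ((td c).bag i)).trans ((td c).card_le i))
      rintro v ⟨h, hv⟩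
      exact ⟨_, hv, rfl⟩

end RootedDecomp

/-- A finite simple graph has special treewidth at most two iff every connected
component of it is a mamba tree. -/
theorem statement17 {V : Type} [Fintype V] (G : SimpleGraph V) :
    spctw G ≤ 2 ↔ ∀ c : G.ConnectedComponent, IsMambaTree (G.induce c.supp) := by
  rw [spctw_le_iff]
  constructor
  · rintro ⟨td⟩ c
    exact isMambaTree_of_rootedDecomp _ rfl (setConn_univ_iff.2 c.connected_toSimpleGraph)
      (td.comap (Embedding.induce c.supp).toHom Subtype.val_injective)
  · intro h
    choose td _ using fun c => exists_true_iff_nonempty.2 (h c).nonempty_rootedDecomp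
    exact ⟨.ofComponents td⟩
end

section
/- For every integer k ≥ 3, none of the following classes of finite simple graphs is closed under taking minors: the graphs of special treewidth at most k, the graphs of spaghetti treewidth at most k, and the graphs of directed spaghetti treewidth at most k. That is, for each of the three parameters p ∈ {spctw, sptw, dptw} there exist a graph G and a minor H of G with p(G) ≤ k and p(H) > k. -/
open SimpleGraph

section TreeLemmas

variable {ι : Type} {T : SimpleGraph ι}

theorem exists_walk_subset_of_induce_connected {S : Set ι} (hS : (T.induce S).Connected)
    {x y : ι} (hx : x ∈ S) (hy : y ∈ S) : ∃ p : T.Walk x y, ∀ t ∈ p.support, t ∈ S := by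
  obtain ⟨p⟩ := hS.preconnected ⟨x, hx⟩ ⟨y, hy⟩
  refine ⟨p.map (Embedding.induce S).toHom, fun t ht => ?_⟩
  obtain ⟨a, -, rfl⟩ := List.mem_map.1
    ((congrArg (t ∈ ·) (Walk.support_map (Embedding.induce S).toHom p)).mp ht)
  exact a.2

theorem exists_path_subset_of_induce_connected {S : Set ι} (hS : (T.induce S).Connected)
    {x y : ι} (hx : x ∈ S) (hy : y ∈ S) :
    ∃ p : T.Walk x y, p.IsPath ∧ ∀ t ∈ p.support, t ∈ S := by
  classical
  obtain ⟨p, hp⟩ := exists_walk_subset_of_induce_connected hS hx hy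
  exact ⟨p.bypass, p.bypass_isPath, fun t ht => hp t (p.support_bypass_subset_support ht)⟩

/-- In a forest, every walk visits all vertices of the path between its ends. -/
theorem SimpleGraph.IsAcyclic.support_subset_of_isPath (hT : T.IsAcyclic) {x y : ι}
    {p : T.Walk x y} (hp : p.IsPath) (q : T.Walk x y) : p.support ⊆ q.support := by
  classical
  have h := (hT.subsingleton_path x y).elim ⟨p, hp⟩ ⟨q.bypass, q.bypass_isPath⟩
  have h' : p = q.bypass := congrArg Subtype.val h
  rw [h']
  exact q.support_bypass_subset_support

/-- A node of a connected set `S` that is closest to `r` lies on every walk from `S` to `r`. -/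
theorem mem_support_of_dist_le (hT : T.IsTree) {S : Set ι} (hS : (T.induce S).Connected)
    {r t x : ι} (ht : t ∈ S) (hx : x ∈ S) (hmin : ∀ y ∈ S, T.dist t r ≤ T.dist y r)
    (p : T.Walk x r) : t ∈ p.support := by
  classical
  obtain ⟨q, hq, hqS⟩ := exists_path_subset_of_induce_connected hS hx ht
  obtain ⟨g, hg, hgd⟩ := hT.connected.exists_path_of_dist t r
  have key : ∀ y ∈ g.support, y ∈ S → y = t := by
    intro y hy hyS
    have h1 := hmin y hyS
    have h2 := dist_le (g.dropUntil y hy)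
    have h3 := congrArg Walk.length (g.take_spec hy)
    rw [Walk.length_append] at h3
    exact (Walk.eq_of_length_eq_zero (p := g.takeUntil y hy) (by omega)).symm
  have hpath : (q.append g).IsPath := by
    rw [Walk.isPath_def, Walk.support_append, List.nodup_append']
    refine ⟨hq.support_nodup, hg.support_nodup.tail, fun y hy hy' => ?_⟩
    have h := key y (List.mem_of_mem_tail hy') (hqS y hy)
    subst h
    have := hg.support_nodup
    rw [← Walk.cons_tail_support] at this
    exact (List.nodup_cons.mp this).1 hy'
  exact hT.isAcyclic.support_subset_of_isPath hpath p
    (by rw [Walk.mem_support_append_iff]; exact Or.inl q.end_mem_support)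

/-- The Helly property of subtrees: a finite family of pairwise intersecting subtrees of a tree
has a common node. -/
theorem exists_common_node_of_pairwise_inter [Finite ι] (hT : T.IsTree) {α : Type} {K : Set α}
    (hKf : K.Finite) (hK : K.Nonempty) (S : α → Set ι) (hS : ∀ v ∈ K, (T.induce (S v)).Connected)
    (hI : ∀ u ∈ K, ∀ v ∈ K, (S u ∩ S v).Nonempty) : ∃ x, ∀ v ∈ K, x ∈ S v := by
  obtain ⟨r⟩ := hT.connected.nonempty
  have htop : ∀ v : α, ∃ t : ι, v ∈ K → t ∈ S v ∧ ∀ y ∈ S v, T.dist t r ≤ T.dist y r := by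
    intro v
    by_cases hv : v ∈ K
    · obtain ⟨x, hx, -⟩ := hI v hv v hv
      obtain ⟨t, ht, hm⟩ := Set.exists_min_image (S v) (fun y => T.dist y r) (Set.toFinite _) ⟨x, hx⟩
      exact ⟨t, fun _ => ⟨ht, hm⟩⟩
    · exact ⟨r, fun h => absurd h hv⟩
  choose t ht using htop
  obtain ⟨v, hv, hmax⟩ := Set.exists_max_image K (fun v => T.dist (t v) r) hKf hK
  refine ⟨t v, fun u hu => ?_⟩
  obtain ⟨x, hxu, hxv⟩ := hI u hu v hv
  obtain ⟨htu, hmu⟩ := ht u hu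
  obtain ⟨htv, hmv⟩ := ht v hv
  obtain ⟨q, hq⟩ := exists_walk_subset_of_induce_connected (hS u hu) hxu htu
  obtain ⟨g, -, hgd⟩ := hT.connected.exists_path_of_dist (t u) r
  have h := mem_support_of_dist_le hT (hS v hv) htv hxv hmv (q.append g)
  rw [Walk.mem_support_append_iff] at h
  rcases h with h | h
  · exact hq _ h
  · classical
    have h1 := hmax u hu
    have h2 := dist_le (g.dropUntil _ h)
    have h3 := congrArg Walk.length (g.take_spec h)
    rw [Walk.length_append] at h3
    have h4 : t u = t v := Walk.eq_of_length_eq_zero (p := g.takeUntil _ h) (by omega)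
    exact h4 ▸ htu

/-- An inner vertex of a path has two neighbours on the path. -/
theorem SimpleGraph.Walk.IsPath.exists_two_neighbors {u v m : ι} {p : T.Walk u v} (hp : p.IsPath)
    (hm : m ∈ p.support) (hu : m ≠ u) (hv : m ≠ v) :
    ∃ a ∈ p.support, ∃ b ∈ p.support, a ≠ b ∧ T.Adj m a ∧ T.Adj m b := by
  induction p with
  | nil => simp_all
  | @cons u u' v h p ih =>
    rw [Walk.cons_isPath_iff] at hp
    have hm' : m ∈ p.support := by simpa [hu] using hm
    by_cases hmu : m = u'
    · subst hmu
      cases p with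
      | nil => exact absurd rfl hv
      | @cons _ b _ h' p =>
        refine ⟨u, by simp, b, by simp, ?_, h.symm, h'⟩
        rintro rfl
        exact hp.2 (by simp)
    · obtain ⟨a, ha, b, hb, h⟩ := ih hp.1 hm' hmu hv
      exact ⟨a, by simp [ha], b, by simp [hb], h⟩

/-- Among three nodes of a path, one lies between the other two. -/
theorem IsPathSet.exists_between [Finite ι] (hT : T.IsAcyclic) {S : Set ι} (hS : IsPathSet T S)
    {x y z : ι} (hx : x ∈ S) (hy : y ∈ S) (hz : z ∈ S) :
    (∀ p : T.Walk y z, x ∈ p.support) ∨ (∀ p : T.Walk x z, y ∈ p.support) ∨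
      (∀ p : T.Walk x y, z ∈ p.support) := by
  classical
  obtain ⟨p, hp, hpS⟩ := exists_path_subset_of_induce_connected hS.1 hx hy
  obtain ⟨q, hq, hqS⟩ := exists_path_subset_of_induce_connected hS.1 hx hz
  by_cases hzp : z ∈ p.support
  · exact Or.inr (Or.inr fun w => hT.support_subset_of_isPath hp w hzp)
  cases q with
  | nil => exact absurd p.start_mem_support hzp
  | @cons _ a _ h q =>
    rw [Walk.cons_isPath_iff] at hq
    by_cases ha : a ∈ p.support
    · obtain ⟨d, hd, hd1, hd2⟩ := q.exists_boundary_dart {t | t ∈ p.support} ha hzp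
      have hdq := q.dart_fst_mem_support_of_mem_darts hd
      have hdq' := q.dart_snd_mem_support_of_mem_darts hd
      by_cases hdy : d.fst = y
      · refine Or.inr (Or.inl fun w => ?_)
        refine hT.support_subset_of_isPath ((Walk.cons_isPath_iff h q).2 hq) w ?_
        rw [← hdy]
        simp [hdq]
      · exfalso
        have hdx : d.fst ≠ x := fun hc => hq.2 (hc ▸ hdq)
        obtain ⟨b, hb, c, hc, hbc, hab, hac⟩ := hp.exists_two_neighbors hd1 hdx hdy
        have hcard := hS.2 d.fst (hpS _ hd1)
        have hsub : ({b, c, d.snd} : Set ι) ⊆ {y | y ∈ S ∧ T.Adj d.fst y} := by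
          rintro t (rfl | rfl | rfl)
          · exact ⟨hpS _ hb, hab⟩
          · exact ⟨hpS _ hc, hac⟩
          · exact ⟨hqS _ (by simp [hdq']), d.adj⟩
        have h3 : ({b, c, d.snd} : Set ι).ncard = 3 := by
          rw [Set.ncard_eq_three]
          exact ⟨b, c, d.snd, hbc, fun e => hd2 (e ▸ hb), fun e => hd2 (e ▸ hc), rfl⟩
        have := Set.ncard_le_ncard hsub (Set.toFinite _)
        omega
    · refine Or.inl fun w => ?_
      have hpath : (Walk.cons h.symm p).IsPath := (Walk.cons_isPath_iff _ _).2 ⟨hp, ha⟩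
      have hmem := hT.support_subset_of_isPath hpath (q.append w.reverse)
        (List.mem_cons_of_mem _ p.start_mem_support)
      rw [Walk.mem_support_append_iff, Walk.support_reverse, List.mem_reverse] at hmem
      exact hmem.resolve_left hq.2

end TreeLemmas

/-- Every finite clique is contained in some bag of a tree decomposition. -/
theorem TreeDecomp.exists_bag_of_isClique {V : Type} {G : SimpleGraph V} (td : TreeDecomp G)
    {K : Set V} (hKf : K.Finite) (hK : K.Nonempty) (hc : G.IsClique K) :
    ∃ x, K ⊆ td.bag x := by
  have := td.finι
  refine exists_common_node_of_pairwise_inter td.isTree hKf hK (fun v => {x | v ∈ td.bag x})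
    (fun v _ => td.bag_conn v) fun u hu v hv => ?_
  by_cases huv : u = v
  · subst huv
    obtain ⟨x, hx⟩ := td.bag_cover u
    exact ⟨x, hx, hx⟩
  · obtain ⟨x, hx⟩ := td.bag_edge (hc hu hv huv)
    exact ⟨x, hx⟩

/-- For a path `a - z - b`, a node separating a bag containing `a` from a bag containing `b` has
one of the three vertices in its bag. -/
theorem TreeDecomp.mem_bag_of_separates {V : Type} {G : SimpleGraph V} (td : TreeDecomp G)
    {a z b : V} (ha : G.Adj z a) (hb : G.Adj z b) {x y t : td.ι} (hx : a ∈ td.bag x)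
    (hy : b ∈ td.bag y) (ht : ∀ p : td.tree.Walk x y, t ∈ p.support) :
    a ∈ td.bag t ∨ z ∈ td.bag t ∨ b ∈ td.bag t := by
  obtain ⟨s, hzs, has⟩ := td.bag_edge ha
  obtain ⟨s', hzs', hbs'⟩ := td.bag_edge hb
  obtain ⟨p, hp⟩ := exists_walk_subset_of_induce_connected (td.bag_conn a) hx has
  obtain ⟨q, hq⟩ := exists_walk_subset_of_induce_connected (td.bag_conn z) hzs hzs'
  obtain ⟨r, hr⟩ := exists_walk_subset_of_induce_connected (td.bag_conn b) hbs' hy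
  have h := ht (p.append (q.append r))
  rw [Walk.mem_support_append_iff, Walk.mem_support_append_iff] at h
  exact h.imp (hp t) (Or.imp (hq t) (hr t))

/-- Let three cliques of size `k + 1` share a vertex `w`, and let a vertex `z` outside of them have
a private neighbour in each of them. Then the spaghetti treewidth is larger than `k`. -/
theorem SpaghettiTD.exists_large_bag {V : Type} [Finite V] {G : SimpleGraph V}
    (td : SpaghettiTD G) {k : ℕ} (w z : V) (a : Fin 3 → V) (B : Fin 3 → Set V)
    (hB : ∀ i, G.IsClique (B i)) (hcard : ∀ i, (B i).ncard = k + 1) (hw : ∀ i, w ∈ B i)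
    (ha : ∀ i, a i ∈ B i) (hz : ∀ i, z ∉ B i) (ha' : ∀ i j, i ≠ j → a i ∉ B j)
    (hza : ∀ i, G.Adj z (a i)) : ∃ x, k + 1 < (td.bag x).ncard := by
  by_contra! hle
  have := td.finι
  choose n hn using fun i =>
    td.toTreeDecomp.exists_bag_of_isClique (Set.toFinite (B i)) ⟨w, hw i⟩ (hB i)
  have hbag : ∀ i, td.bag (n i) = B i := fun i =>
    (Set.eq_of_subset_of_ncard_le (hn i) (by rw [hcard]; exact hle _) (Set.toFinite _)).symm
  have hsep : ∀ i j l, i ≠ j → l ≠ j → ¬ ∀ p : td.tree.Walk (n i) (n l), n j ∈ p.support := by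
    intro i j l hij hlj hp
    have h := td.toTreeDecomp.mem_bag_of_separates (hza i) (hza l) (hn i (ha i)) (hn l (ha l)) hp
    rw [hbag] at h
    exact h.elim (ha' i j hij) fun h => h.elim (hz j) (ha' l j hlj)
  rcases (td.bag_path w).exists_between td.isTree.isAcyclic (hn 0 (hw 0)) (hn 1 (hw 1))
    (hn 2 (hw 2)) with h | h | h
  · exact hsep 1 0 2 (by decide) (by decide) h
  · exact hsep 0 1 2 (by decide) (by decide) h
  · exact hsep 0 2 1 (by decide) (by decide) h

section WidthComparison

variable {V W : Type} {G : SimpleGraph V} {H : SimpleGraph W}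

/-- Transport of a special tree decomposition along a graph isomorphism. -/
def SpecialTD.ofIso (φ : G ≃g H) (td : SpecialTD H) : SpecialTD G where
  ι := td.ι
  finι := td.finι
  tree := td.tree
  isTree := td.isTree
  bag x := φ ⁻¹' td.bag x
  bag_cover v := td.bag_cover (φ v)
  bag_edge _ _ h := td.bag_edge (φ.map_adj_iff.2 h)
  bag_conn v := td.bag_conn (φ v)
  root := td.root
  bag_vertical v := td.bag_vertical (φ v)

/-- Transport of a spaghetti tree decomposition along a graph isomorphism. -/
def SpaghettiTD.ofIso (φ : G ≃g H) (td : SpaghettiTD H) : SpaghettiTD G where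
  ι := td.ι
  finι := td.finι
  tree := td.tree
  isTree := td.isTree
  bag x := φ ⁻¹' td.bag x
  bag_cover v := td.bag_cover (φ v)
  bag_edge _ _ h := td.bag_edge (φ.map_adj_iff.2 h)
  bag_conn v := td.bag_conn (φ v)
  bag_path v := td.bag_path (φ v)

theorem SimpleGraph.Iso.ncard_preimage (φ : G ≃g H) (s : Set W) :
    (φ ⁻¹' s).ncard = s.ncard :=
  Set.ncard_preimage_of_injective_subset_range φ.injective (by simp [φ.surjective.range_eq])

/-- A special tree decomposition is a directed one, with all edges oriented towards the root. -/
def SpecialTD.toDirSpaghettiTD (td : SpecialTD G) : DirSpaghettiTD G where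
  toTreeDecomp := td.toTreeDecomp
  orient x y := td.tree.Adj x y ∧ td.tree.dist y td.root < td.tree.dist x td.root
  orient_iff x y := by
    refine ⟨fun h => ?_, fun h => h.elim (fun h => h.1) fun h => h.1.symm⟩
    have hne := td.isTree.dist_ne_of_adj td.root h
    rw [dist_comm, dist_comm (v := y)] at hne
    exact hne.lt_or_gt.elim (fun h' => Or.inr ⟨h.symm, h'⟩) fun h' => Or.inl ⟨h, h'⟩
  orient_asymm _ _ h h' := lt_asymm h.2 h'.2
  bag_dirpath := td.bag_vertical

/-- Forgetting the orientation of a directed spaghetti tree decomposition. -/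
def DirSpaghettiTD.toSpaghettiTD (td : DirSpaghettiTD G) : SpaghettiTD G where
  toTreeDecomp := td.toTreeDecomp
  bag_path v := (td.bag_dirpath v).1

/-- The special tree decomposition with a single bag. -/
def SpecialTD.trivial (G : SimpleGraph V) : SpecialTD G where
  ι := Unit
  finι := inferInstance
  tree := ⊥
  isTree := IsTree.of_subsingleton
  bag _ := Set.univ
  bag_cover _ := ⟨(), Set.mem_univ _⟩
  bag_edge _ _ _ := ⟨(), Set.mem_univ _, Set.mem_univ _⟩
  bag_conn v := by
    have : Nonempty {x : Unit | v ∈ (Set.univ : Set V)} := ⟨⟨(), Set.mem_univ v⟩⟩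
    exact Connected.of_subsingleton
  root := ()
  bag_vertical v := by
    have : Nonempty {x : Unit | v ∈ (Set.univ : Set V)} := ⟨⟨(), Set.mem_univ v⟩⟩
    exact ⟨⟨Connected.of_subsingleton, by simp⟩, by simp, by simp⟩

theorem SpecialTD.trivial_ncard_bag_le (G : SimpleGraph V) (x : (SpecialTD.trivial G).ι) :
    ((SpecialTD.trivial G).bag x).ncard ≤ Nat.card V + 1 := by
  change (Set.univ : Set V).ncard ≤ _
  rw [Set.ncard_univ]
  omega

theorem spctw_le {k : ℕ} (td : SpecialTD G) (h : ∀ x, (td.bag x).ncard ≤ k + 1) :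
    spctw G ≤ k := Nat.sInf_le ⟨td, h⟩

theorem dptw_le {k : ℕ} (td : DirSpaghettiTD G) (h : ∀ x, (td.bag x).ncard ≤ k + 1) :
    dptw G ≤ k := Nat.sInf_le ⟨td, h⟩

theorem sptw_le {k : ℕ} (td : SpaghettiTD G) (h : ∀ x, (td.bag x).ncard ≤ k + 1) :
    sptw G ≤ k := Nat.sInf_le ⟨td, h⟩

theorem exists_specialTD_ncard_le_spctw (G : SimpleGraph V) :
    ∃ td : SpecialTD G, ∀ x, (td.bag x).ncard ≤ spctw G + 1 :=
  Nat.sInf_mem (s := {k | ∃ td : SpecialTD G, ∀ x, (td.bag x).ncard ≤ k + 1})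
    ⟨_, _, SpecialTD.trivial_ncard_bag_le G⟩

theorem exists_dirSpaghettiTD_ncard_le_dptw (G : SimpleGraph V) :
    ∃ td : DirSpaghettiTD G, ∀ x, (td.bag x).ncard ≤ dptw G + 1 :=
  Nat.sInf_mem (s := {k | ∃ td : DirSpaghettiTD G, ∀ x, (td.bag x).ncard ≤ k + 1})
    ⟨_, (SpecialTD.trivial G).toDirSpaghettiTD, SpecialTD.trivial_ncard_bag_le G⟩

theorem exists_spaghettiTD_ncard_le_sptw (G : SimpleGraph V) :
    ∃ td : SpaghettiTD G, ∀ x, (td.bag x).ncard ≤ sptw G + 1 :=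
  Nat.sInf_mem (s := {k | ∃ td : SpaghettiTD G, ∀ x, (td.bag x).ncard ≤ k + 1})
    ⟨_, (SpecialTD.trivial G).toDirSpaghettiTD.toSpaghettiTD, SpecialTD.trivial_ncard_bag_le G⟩

theorem dptw_le_spctw (G : SimpleGraph V) : dptw G ≤ spctw G := by
  obtain ⟨td, h⟩ := exists_specialTD_ncard_le_spctw G
  exact dptw_le td.toDirSpaghettiTD h

theorem sptw_le_dptw (G : SimpleGraph V) : sptw G ≤ dptw G := by
  obtain ⟨td, h⟩ := exists_dirSpaghettiTD_ncard_le_dptw G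
  exact sptw_le td.toSpaghettiTD h

theorem spctw_le_of_iso (φ : G ≃g H) : spctw G ≤ spctw H := by
  obtain ⟨td, h⟩ := exists_specialTD_ncard_le_spctw H
  exact spctw_le (td.ofIso φ) fun x => (φ.ncard_preimage _).trans_le (h x)

theorem sptw_le_of_iso (φ : G ≃g H) : sptw G ≤ sptw H := by
  obtain ⟨td, h⟩ := exists_spaghettiTD_ncard_le_sptw H
  exact sptw_le (td.ofIso φ) fun x => (φ.ncard_preimage _).trans_le (h x)

end WidthComparison

theorem IsMinorOf.of_iso {V V' W W' : Type} {G : SimpleGraph V} {G' : SimpleGraph V'}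
    {H : SimpleGraph W} {H' : SimpleGraph W'} (h : IsMinorOf H G) (φ : G ≃g G') (ψ : H' ≃g H) :
    IsMinorOf H' G' := by
  obtain ⟨f, hne, hconn, hdisj, hadj⟩ := h
  refine ⟨fun w => φ '' f (ψ w), fun w => (hne _).image _, fun w => ?_, fun w w' hw => ?_, ?_⟩
  · let g : G.induce (f (ψ w)) →g G'.induce (φ '' f (ψ w)) :=
      ⟨fun x => ⟨φ x, x, x.2, rfl⟩, fun h => φ.map_adj_iff.2 h⟩
    refine (hconn (ψ w)).map g ?_
    rintro ⟨_, x, hx, rfl⟩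
    exact ⟨⟨x, hx⟩, rfl⟩
  · exact Set.disjoint_image_of_injective φ.injective (hdisj (ψ.injective.ne hw))
  · intro w w' hw
    obtain ⟨u, hu, v, hv, huv⟩ := hadj (ψ.map_adj_iff.2 hw)
    exact ⟨φ u, ⟨u, hu, rfl⟩, φ v, ⟨v, hv, rfl⟩, φ.map_adj_iff.2 huv⟩

/-- Three cliques on `n + 2` vertices sharing the vertex `inl 0`, together with the vertex `inl 1`,
which has one private neighbour in each of the cliques. -/
def threeCliques (n : ℕ) : SimpleGraph (Fin 2 ⊕ Fin 3 × Fin (n + 1)) :=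
  SimpleGraph.fromRel (fun p q =>
    match p, q with
    | Sum.inl u, Sum.inr x => u = 0 ∨ x.2 = 0
    | Sum.inr x, Sum.inr y => x.1 = y.1
    | _, _ => False)

/-- The graph obtained from `threeCliques n` by splitting the vertex shared by the three cliques
into two adjacent vertices: `inl 0`, which lies in two of the cliques, and `inl 1`, which lies in
the third one. -/
def splitThreeCliques (n : ℕ) : SimpleGraph (Fin 3 ⊕ Fin 3 × Fin (n + 1)) :=
  SimpleGraph.fromRel (fun p q =>
    match p, q with
    | Sum.inl u, Sum.inl v => u = 0 ∧ v = 1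
    | Sum.inl u, Sum.inr x => (u = 0 ∧ x.1 ≠ 2) ∨ (u = 1 ∧ x.1 = 2) ∨ (u = 2 ∧ x.2 = 0)
    | Sum.inr x, Sum.inr y => x.1 = y.1
    | Sum.inr _, Sum.inl _ => False)

theorem threeCliques_isMinorOf (n : ℕ) : IsMinorOf (threeCliques n) (splitThreeCliques n) := by
  have hw : (splitThreeCliques n).Adj (.inl 0) (.inl 1) := by simp [splitThreeCliques]
  refine ⟨Sum.elim ![{.inl 0, .inl 1}, {.inl 2}] fun x => {.inr x}, ?_, ?_, ?_, ?_⟩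
  · rintro (u | x)
    · fin_cases u <;> simp
    · simp
  · rintro (u | x)
    · fin_cases u
      · exact induce_pair_connected_of_adj hw
      · simp
    · simp
  · rintro (u | x) (v | y) h
    · fin_cases u <;> fin_cases v <;> simp at h ⊢
    · fin_cases u <;> simp
    · fin_cases v <;> simp
    · simpa using fun e => h (by rw [e])
  · have key : ∀ (u : Fin 2) (x : Fin 3 × Fin (n + 1)), u = 0 ∨ x.2 = 0 →
        ∃ v ∈ (![{.inl 0, .inl 1}, {.inl 2}] : Fin 2 → Set (Fin 3 ⊕ Fin 3 × Fin (n + 1))) u,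
          (splitThreeCliques n).Adj v (.inr x) := by
      intro u x h
      fin_cases u
      · by_cases hx : x.1 = 2
        · exact ⟨.inl 1, by simp, by simp [splitThreeCliques, hx]⟩
        · exact ⟨.inl 0, by simp, by simp [splitThreeCliques, hx]⟩
      · exact ⟨.inl 2, by simp, by simpa [splitThreeCliques] using h⟩
    rintro (u | x) (v | y) h
    · simp [threeCliques] at h
    · obtain ⟨v, hv, hadj⟩ := key u y (by simpa [threeCliques] using h)
      exact ⟨v, hv, _, rfl, hadj⟩
    · obtain ⟨u, hu, hadj⟩ := key v x (by simpa [threeCliques] using h)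
      exact ⟨_, rfl, u, hu, hadj.symm⟩
    · refine ⟨_, rfl, _, rfl, ?_⟩
      simpa [threeCliques, splitThreeCliques] using h

theorem lt_sptw_threeCliques (n : ℕ) : n + 1 < sptw (threeCliques n) := by
  obtain ⟨td, htd⟩ := exists_spaghettiTD_ncard_le_sptw (threeCliques n)
  obtain ⟨x, hx⟩ := td.exists_large_bag (k := n + 1) (.inl 0) (.inl 1) (fun i => .inr (i, 0))
    (fun i => insert (.inl 0) (Set.range fun b => .inr (i, b))) (fun i => by
      rintro _ (rfl | ⟨b, rfl⟩) _ (rfl | ⟨c, rfl⟩) h <;> simp_all [threeCliques]) (fun i => by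
      rw [Set.ncard_insert_of_notMem (by simp), Set.ncard_range_of_injective
        (fun b c h => by simpa using h), Nat.card_fin])
    (by simp) (by simp) (by simp) (fun i j h => by simp [h.symm]) (by simp [threeCliques])
  have := htd x
  omega

section RootedTree

/-- Parent function of the rooted tree `spiderTree`. -/
def spiderParent : Fin 6 → Fin 6 := ![0, 0, 1, 2, 3, 2]

/-- Distance to the root in the rooted tree `spiderTree`. -/
def spiderDepth : Fin 6 → ℕ := ![0, 1, 2, 3, 4, 3]

/-- The path `0 1 2 3 4` with a further leaf `5` attached to `2`. -/
def spiderTree : SimpleGraph (Fin 6) := SimpleGraph.fromRel (fun x y => spiderParent x = y)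

instance : DecidableRel spiderTree.Adj := fun x y =>
  inferInstanceAs (Decidable (x ≠ y ∧ (spiderParent x = y ∨ spiderParent y = x)))

theorem spiderTree_induce_connected {s : Set (Fin 6)} {t : Fin 6} (ht : t ∈ s)
    (hs : ∀ x ∈ s, x = t ∨ (spiderParent x < x ∧ spiderParent x ∈ s)) :
    (spiderTree.induce s).Connected := by
  have key : ∀ x (hx : x ∈ s), (spiderTree.induce s).Reachable ⟨x, hx⟩ ⟨t, ht⟩ := by
    intro x
    induction x using WellFoundedLT.induction with
    | _ x ih =>
      intro hx
      rcases hs x hx with rfl | ⟨hlt, hmem⟩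
      · rfl
      · have hadj : spiderTree.Adj x (spiderParent x) := ⟨hlt.ne', Or.inl rfl⟩
        exact Reachable.trans (Adj.reachable (G := spiderTree.induce s) (v := ⟨_, hmem⟩) hadj)
          (ih _ hlt hmem)
  have : Nonempty s := ⟨⟨t, ht⟩⟩
  exact ⟨fun x y => (key x.1 x.2).trans (key y.1 y.2).symm⟩

theorem spiderTree_isTree : spiderTree.IsTree := by
  rw [isTree_iff_connected_and_card]
  constructor
  · rw [← (induceUnivIso spiderTree).connected_iff]
    exact spiderTree_induce_connected (Set.mem_univ 0) (by simp; decide)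
  · rw [Nat.card_eq_fintype_card, ← edgeFinset_card, Nat.card_fin]
    decide

theorem spiderTree_dist_root (x : Fin 6) : spiderTree.dist x 0 = spiderDepth x := by
  have hlip : ∀ x y, spiderTree.Adj x y → spiderDepth x ≤ spiderDepth y + 1 := by decide
  have hpar : ∀ x, x ≠ 0 → spiderParent x < x ∧ spiderTree.Adj x (spiderParent x) ∧
      spiderDepth x = spiderDepth (spiderParent x) + 1 := by decide
  apply le_antisymm
  · induction x using WellFoundedLT.induction with
    | _ x ih =>
      by_cases hx : x = 0
      · simp [hx]
      · obtain ⟨hlt, hadj, hd⟩ := hpar x hx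
        have h1 := spiderTree_isTree.connected.dist_triangle (u := x) (v := spiderParent x) (w := 0)
        rw [dist_eq_one_iff_adj.2 hadj] at h1
        have := ih _ hlt
        omega
  · have hwalk : ∀ {x y : Fin 6} (p : spiderTree.Walk x y),
        spiderDepth x ≤ p.length + spiderDepth y := by
      intro x y p
      induction p with
      | nil => simp
      | cons h p ih =>
        have := hlip _ _ h
        rw [Walk.length_cons]
        omega
    obtain ⟨p, hp⟩ := spiderTree_isTree.connected.exists_walk_length_eq_dist x 0
    have h := hwalk p
    rwa [hp] at h

theorem isDirPathSet_spiderTree {s : Finset (Fin 6)}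
    (hs : ∃ t ∈ s, ∀ x ∈ s, x = t ∨ (spiderParent x < x ∧ spiderParent x ∈ s))
    (hadj : ∀ x ∈ s, (s.filter fun y => spiderTree.Adj x y).card ≤ 2)
    (hup : ∀ x ∈ s,
      (s.filter fun y => spiderTree.Adj x y ∧ spiderDepth y < spiderDepth x).card ≤ 1)
    (hdown : ∀ x ∈ s,
      (s.filter fun y => spiderTree.Adj y x ∧ spiderDepth x < spiderDepth y).card ≤ 1) :
    IsDirPathSet spiderTree
      (fun x y => spiderTree.Adj x y ∧ spiderTree.dist y 0 < spiderTree.dist x 0) {x | x ∈ s} := by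
  obtain ⟨t, ht, hs⟩ := hs
  simp only [spiderTree_dist_root]
  refine ⟨⟨spiderTree_induce_connected ht hs, fun x hx => ?_⟩, fun x hx => ?_, fun x hx => ?_⟩
  · simpa [← Set.ncard_coe_finset] using hadj x hx
  · simpa [← Set.ncard_coe_finset] using hup x hx
  · simpa [← Set.ncard_coe_finset] using hdown x hx

end RootedTree

/-- The nodes of `spiderTree` whose bags contain a given vertex of `splitThreeCliques n`. -/
def splitThreeCliquesNodes (n : ℕ) : Fin 3 ⊕ Fin 3 × Fin (n + 1) → Finset (Fin 6)
  | Sum.inl u => ![{0, 1, 2, 3, 4}, {2, 5}, {1, 2, 3}] u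
  | Sum.inr x =>
    if x.2 = 0 then ![{0, 1}, {3, 4}, {2, 5}] x.1 else ![{0}, {4}, {5}] x.1

theorem isDirPathSet_splitThreeCliquesNodes (n : ℕ) (v : Fin 3 ⊕ Fin 3 × Fin (n + 1)) :
    IsDirPathSet spiderTree
      (fun x y => spiderTree.Adj x y ∧ spiderTree.dist y 0 < spiderTree.dist x 0)
      {x | x ∈ splitThreeCliquesNodes n v} := by
  rcases v with u | ⟨i, b⟩
  · simp only [splitThreeCliquesNodes]
    fin_cases u <;>
      exact isDirPathSet_spiderTree (by decide) (by decide) (by decide) (by decide)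
  · by_cases hb : b = 0 <;> simp only [splitThreeCliquesNodes, hb, if_true, if_false] <;>
      fin_cases i <;>
      exact isDirPathSet_spiderTree (by decide) (by decide) (by decide) (by decide)

/-- A special tree decomposition of `splitThreeCliques n`. -/
def splitThreeCliquesTD (n : ℕ) : SpecialTD (splitThreeCliques n) where
  ι := Fin 6
  finι := inferInstance
  tree := spiderTree
  isTree := spiderTree_isTree
  bag x := {v | x ∈ splitThreeCliquesNodes n v}
  bag_cover v := by
    obtain ⟨x, hx⟩ := (isDirPathSet_splitThreeCliquesNodes n v).1.1.nonempty
    exact ⟨x, hx⟩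
  bag_edge := by
    have hin : ∀ i b, (![0, 4, 5] : Fin 3 → Fin 6) i ∈ splitThreeCliquesNodes n (.inr (i, b)) := by
      intro i b
      by_cases hb : b = 0 <;> fin_cases i <;> simp [splitThreeCliquesNodes, hb]
    have key : ∀ (u : Fin 3) (x : Fin 3 × Fin (n + 1)),
        (u = 0 ∧ x.1 ≠ 2) ∨ (u = 1 ∧ x.1 = 2) ∨ (u = 2 ∧ x.2 = 0) →
        ∃ t, t ∈ splitThreeCliquesNodes n (.inl u) ∧ t ∈ splitThreeCliquesNodes n (.inr x) := by
      rintro u ⟨i, b⟩ (⟨rfl, h⟩ | ⟨rfl, h⟩ | ⟨rfl, h⟩)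
      · refine ⟨_, ?_, hin i b⟩
        revert h
        fin_cases i <;> simp [splitThreeCliquesNodes]
      · refine ⟨_, ?_, hin i b⟩
        obtain rfl : i = 2 := h
        simp [splitThreeCliquesNodes]
      · obtain rfl : b = 0 := h
        refine ⟨(![1, 3, 2] : Fin 3 → Fin 6) i, ?_, ?_⟩ <;>
          fin_cases i <;> simp [splitThreeCliquesNodes]
    rintro (u | x) (v | y) h
    · refine ⟨2, ?_⟩
      fin_cases u <;> fin_cases v <;> simp [splitThreeCliques, splitThreeCliquesNodes] at h ⊢
    · exact key u y (by simpa [splitThreeCliques] using h)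
    · obtain ⟨t, h1, h2⟩ := key v x (by simpa [splitThreeCliques] using h)
      exact ⟨t, h2, h1⟩
    · obtain ⟨i, b⟩ := x
      obtain ⟨j, c⟩ := y
      have hij : i = j := by
        have := h.2
        simp only at this
        exact this.elim id Eq.symm
      subst hij
      exact ⟨_, hin i b, hin i c⟩
  bag_conn v := (isDirPathSet_splitThreeCliquesNodes n v).1.1
  root := 0
  bag_vertical := isDirPathSet_splitThreeCliquesNodes n

theorem spctw_splitThreeCliques_le (n : ℕ) (hn : 2 ≤ n) : spctw (splitThreeCliques n) ≤ n + 1 := by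
  refine spctw_le (splitThreeCliquesTD n) fun (x : Fin 6) => ?_
  have hclique : ∀ (u : Fin 3) (i : Fin 3),
      (insert (.inl u) (Set.range fun b => .inr (i, b)) :
        Set (Fin 3 ⊕ Fin 3 × Fin (n + 1))).ncard ≤ n + 1 + 1 := fun u i => by
    refine (Set.ncard_insert_le _ _).trans ?_
    rw [Set.ncard_range_of_injective (fun b c h => by simpa using h), Nat.card_fin]
  have hsmall : ∀ a b c d : Fin 3 ⊕ Fin 3 × Fin (n + 1),
      ({a, b, c, d} : Set (Fin 3 ⊕ Fin 3 × Fin (n + 1))).ncard ≤ n + 1 + 1 := fun a b c d => by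
    have h1 := Set.ncard_insert_le a {b, c, d}
    have h2 := Set.ncard_insert_le b {c, d}
    have h3 := Set.ncard_insert_le c {d}
    rw [Set.ncard_singleton] at h3
    omega
  have hsub : ∀ (x : Fin 6) (t : Set (Fin 3 ⊕ Fin 3 × Fin (n + 1))), t.ncard ≤ n + 1 + 1 →
      (∀ u, x ∈ splitThreeCliquesNodes n (.inl u) → .inl u ∈ t) →
      (∀ i b, x ∈ splitThreeCliquesNodes n (.inr (i, b)) → .inr (i, b) ∈ t) →
      {v | x ∈ splitThreeCliquesNodes n v}.ncard ≤ n + 1 + 1 := by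
    intro x t ht hl hr
    refine (Set.ncard_le_ncard ?_ (Set.toFinite t)).trans ht
    rintro (u | ⟨i, b⟩) h
    · exact hl u h
    · exact hr i b h
  change {v | x ∈ splitThreeCliquesNodes n v}.ncard ≤ n + 1 + 1
  fin_cases x
  · refine hsub _ _ (hclique 0 0) (fun u h => ?_) fun i b h => ?_
    · fin_cases u <;> simp [splitThreeCliquesNodes] at h ⊢
    · by_cases hb : b = 0 <;> fin_cases i <;> simp [splitThreeCliquesNodes, hb] at h ⊢
  · refine hsub _ _ (hsmall (.inl 0) (.inl 2) (.inr (0, 0)) (.inr (0, 0))) (fun u h => ?_)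
      fun i b h => ?_
    · fin_cases u <;> simp [splitThreeCliquesNodes] at h ⊢
    · by_cases hb : b = 0 <;> fin_cases i <;> simp [splitThreeCliquesNodes, hb] at h ⊢
  · refine hsub _ _ (hsmall (.inl 0) (.inl 1) (.inl 2) (.inr (2, 0))) (fun u h => ?_)
      fun i b h => ?_
    · fin_cases u <;> simp [splitThreeCliquesNodes] at h ⊢
    · by_cases hb : b = 0 <;> fin_cases i <;> simp [splitThreeCliquesNodes, hb] at h ⊢
  · refine hsub _ _ (hsmall (.inl 0) (.inl 2) (.inr (1, 0)) (.inr (1, 0))) (fun u h => ?_)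
      fun i b h => ?_
    · fin_cases u <;> simp [splitThreeCliquesNodes] at h ⊢
    · by_cases hb : b = 0 <;> fin_cases i <;> simp [splitThreeCliquesNodes, hb] at h ⊢
  · refine hsub _ _ (hclique 0 1) (fun u h => ?_) fun i b h => ?_
    · fin_cases u <;> simp [splitThreeCliquesNodes] at h ⊢
    · by_cases hb : b = 0 <;> fin_cases i <;> simp [splitThreeCliquesNodes, hb] at h ⊢
  · refine hsub _ _ (hclique 1 2) (fun u h => ?_) fun i b h => ?_
    · fin_cases u <;> simp [splitThreeCliquesNodes] at h ⊢
    · by_cases hb : b = 0 <;> fin_cases i <;> simp [splitThreeCliquesNodes, hb] at h ⊢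

/-- For every `k ≥ 3`, none of the classes of graphs of special treewidth at most
`k`, spaghetti treewidth at most `k`, and directed spaghetti treewidth at most `k`
is closed under taking minors. -/
theorem statement18 (k : ℕ) (hk : 3 ≤ k) :
    (∃ (n m : ℕ) (G : SimpleGraph (Fin n)) (H : SimpleGraph (Fin m)),
        IsMinorOf H G ∧ spctw G ≤ k ∧ k < spctw H) ∧
    (∃ (n m : ℕ) (G : SimpleGraph (Fin n)) (H : SimpleGraph (Fin m)),
        IsMinorOf H G ∧ sptw G ≤ k ∧ k < sptw H) ∧
    (∃ (n m : ℕ) (G : SimpleGraph (Fin n)) (H : SimpleGraph (Fin m)),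
        IsMinorOf H G ∧ dptw G ≤ k ∧ k < dptw H) := by
  obtain ⟨n, rfl⟩ : ∃ n, k = n + 1 := ⟨k - 1, by omega⟩
  have φ := Iso.comap (Fintype.equivFin _).symm (splitThreeCliques n)
  have ψ := Iso.comap (Fintype.equivFin _).symm (threeCliques n)
  have hminor := (threeCliques_isMinorOf n).of_iso φ.symm ψ
  have hG := (spctw_le_of_iso φ).trans (spctw_splitThreeCliques_le n (by omega))
  have hH := (lt_sptw_threeCliques n).trans_le (sptw_le_of_iso ψ.symm)
  have hG' := (dptw_le_spctw _).trans hG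
  have hH' := hH.trans_le (sptw_le_dptw _)
  exact ⟨⟨_, _, _, _, hminor, hG, hH'.trans_le (dptw_le_spctw _)⟩,
    ⟨_, _, _, _, hminor, (sptw_le_dptw _).trans hG', hH⟩, ⟨_, _, _, _, hminor, hG', hH'⟩⟩
end

section
/- For every integer k ≥ 3, the class of finite simple graphs with strongly chordal treewidth at most k is not closed under taking minors: there exist a graph G and a minor H of G such that sctw(G) ≤ k and sctw(H) > k. -/
open SimpleGraph

theorem cycGraph_adj_add_one {n : ℕ} (hn : 4 ≤ n) (i : ZMod n) :
    (cycGraph n).Adj i (i + 1) := by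
  have : Fact (1 < n) := ⟨by omega⟩
  simp [cycGraph]

theorem cycGraph_not_adj_add_two {n : ℕ} (hn : 4 ≤ n) (i : ZMod n) :
    ¬ (cycGraph n).Adj i (i + 2) := by
  have key : ∀ a : ℕ, 0 < a → a < n → ((a : ℕ) : ZMod n) ≠ 0 := by
    intro a ha han h
    exact absurd (Nat.le_of_dvd ha ((ZMod.natCast_eq_zero_iff a n).1 h)) (by omega)
  have h1 := key 1 (by omega) (by omega)
  have h3 := key 3 (by omega) (by omega)
  push_cast at h1 h3
  simp only [cycGraph, fromRel_adj, not_and, not_or]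
  refine fun _ => ⟨fun h => h3 ?_, fun h => h1 ?_⟩
  · linear_combination -h
  · linear_combination h

theorem IsChordal.of_adj_add_two {V : Type} {G : SimpleGraph V}
    (h : ∀ n : ℕ, 4 ≤ n → ∀ f : ZMod n → V, Function.Injective f →
      (∀ i, G.Adj (f i) (f (i + 1))) → ∃ i, G.Adj (f i) (f (i + 2))) : IsChordal G := by
  rintro S n hn ⟨φ⟩
  obtain ⟨i, hi⟩ := h n hn (fun i => (φ.symm i : V))
    (Subtype.val_injective.comp φ.symm.injective)
    (fun i => by
      have := φ.symm.map_adj_iff.2 (cycGraph_adj_add_one hn i)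
      simpa using this)
  have h2 : (G.induce S).Adj (φ.symm i) (φ.symm (i + 2)) := by simpa using hi
  exact cycGraph_not_adj_add_two hn i (φ.symm.map_adj_iff.1 h2)

theorem IsChordal.comap {V W : Type} {K : SimpleGraph W} (hK : IsChordal K) (φ : V ↪ W) :
    IsChordal (K.comap φ) := by
  rintro S n hn ⟨ψ⟩
  refine hK (Set.image φ S) n hn ⟨RelIso.trans (RelIso.symm ?_) ψ⟩
  exact ⟨Equiv.Set.image φ S φ.injective, by simp⟩

theorem IsStronglyChordal.comap {V W : Type} {K : SimpleGraph W} (hK : IsStronglyChordal K)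
    (φ : V ↪ W) : IsStronglyChordal (K.comap φ) :=
  ⟨hK.1.comap φ, fun n hn he f hf hadj => hK.2 n hn he (φ ∘ f) (φ.injective.comp hf) hadj⟩

theorem isStronglyChordal_top (V : Type) : IsStronglyChordal (⊤ : SimpleGraph V) := by
  have key : ∀ {n : ℕ} (a : ℕ), 0 < a → a < n → ∀ i : ZMod n, i ≠ i + (a : ZMod n) := by
    intro n a ha han i h
    have h0 : (a : ZMod n) = 0 := by linear_combination -h
    exact absurd (Nat.le_of_dvd ha ((ZMod.natCast_eq_zero_iff a n).1 h0)) (by omega)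
  refine ⟨IsChordal.of_adj_add_two fun n hn f hf _ => ⟨0, ?_⟩, fun n hn _ f hf _ =>
    ⟨0, 3, by decide, le_rfl, by omega, ?_⟩⟩
  · exact fun h => key 2 (by omega) (by omega) _ (hf h)
  · exact fun h => key 3 (by omega) (by omega) _ (hf h)

/-- If `N[f (i + 1)]` and `N[f (i - 1)]` are nested within the cycle, the cycle has an odd chord. -/
theorem exists_odd_chord_of_nested {V : Type} {G : SimpleGraph V} {n : ℕ} (hn : 6 ≤ n)
    {f : ZMod n → V} (hf : Function.Injective f) (hadj : ∀ i, G.Adj (f i) (f (i + 1)))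
    (i : ZMod n)
    (h : (∀ j, G.Adj (f (i - 1)) (f j) → f j = f (i + 1) ∨ G.Adj (f (i + 1)) (f j)) ∨
      (∀ j, G.Adj (f (i + 1)) (f j) → f j = f (i - 1) ∨ G.Adj (f (i - 1)) (f j))) :
    ∃ (i : ZMod n) (d : ℕ), Odd d ∧ 3 ≤ d ∧ d + 3 ≤ n ∧ G.Adj (f i) (f (i + (d : ZMod n))) := by
  have h3 : ((3 : ℕ) : ZMod n) ≠ 0 := fun h =>
    absurd (Nat.le_of_dvd (by omega) ((ZMod.natCast_eq_zero_iff 3 n).1 h)) (by omega)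
  push_cast at h3
  rcases h with h | h
  · refine ⟨i - 2, 3, by decide, le_rfl, by omega, ?_⟩
    have e1 : i - 2 + 1 = i - 1 := by ring
    have e2 : i - 2 + ((3 : ℕ) : ZMod n) = i + 1 := by push_cast; ring
    rw [e2]
    rcases h (i - 2) (e1 ▸ hadj (i - 2)).symm with h | h
    · exact absurd (hf h) fun h => h3 (by linear_combination -h)
    · exact h.symm
  · refine ⟨i - 1, 3, by decide, le_rfl, by omega, ?_⟩
    have e1 : i + 1 + 1 = i + 2 := by ring
    have e2 : i - 1 + ((3 : ℕ) : ZMod n) = i + 2 := by push_cast; ring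
    rw [e2]
    rcases h (i + 2) (e1 ▸ hadj (i + 1)) with h | h
    · exact absurd (hf h) fun h => h3 (by linear_combination h)
    · exact h

theorem sctw_eq_of_iso {V W : Type} {G : SimpleGraph V} {H : SimpleGraph W} (φ : G ≃g H) :
    sctw G = sctw H := by
  have key : ∀ {V W : Type} {G : SimpleGraph V} {H : SimpleGraph W} (φ : G ≃g H) (k : ℕ),
      (∃ K : SimpleGraph W, H ≤ K ∧ IsStronglyChordal K ∧ K.CliqueFree (k + 2)) →
      ∃ K : SimpleGraph V, G ≤ K ∧ IsStronglyChordal K ∧ K.CliqueFree (k + 2) := by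
    rintro V W G H φ k ⟨K, hHK, hK, hfree⟩
    exact ⟨K.comap φ.toEquiv.toEmbedding, fun _ _ h => hHK (φ.map_adj_iff.2 h), hK.comap _,
      hfree.comap ⟨(Embedding.comap φ.toEquiv.toEmbedding K).toCopy⟩⟩
  unfold sctw
  congr 1
  ext k
  exact ⟨key φ.symm k, key φ k⟩

theorem isMinorOf_of_cliqueFibers {V W : Type} {G : SimpleGraph V} {H : SimpleGraph W}
    (Φ : V → W) (hΦ : Function.Surjective Φ) (hfib : ∀ u v, u ≠ v → Φ u = Φ v → G.Adj u v)
    (hedge : ∀ w w', H.Adj w w' → ∃ u v, Φ u = w ∧ Φ v = w' ∧ G.Adj u v) : IsMinorOf H G := by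
  refine ⟨fun w => {v | Φ v = w}, hΦ, fun w => ?_, fun w w' hne => ?_, fun w w' h => ?_⟩
  · obtain ⟨v, hv⟩ := hΦ w
    have : Nonempty {v | Φ v = w} := ⟨⟨v, hv⟩⟩
    refine ⟨fun a b => ?_⟩
    by_cases hab : a = b
    · exact hab ▸ Reachable.refl a
    · refine Adj.reachable ?_
      exact hfib _ _ (fun h => hab (Subtype.ext h)) (a.2.trans b.2.symm)
  · exact Set.disjoint_left.2 fun v hv hv' => hne (hv.symm.trans hv')
  · obtain ⟨u, v, hu, hv, huv⟩ := hedge w w' h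
    exact ⟨u, hu, v, hv, huv⟩

/-- The complete graph on `A` together with three cliques of size `m`, the `j`-th of which is
completely joined to the vertices `l j` and `r j` of `A`. -/
def attachCliques {A : Type} (l r : Fin 3 → A) (m : ℕ) : SimpleGraph (A ⊕ Fin 3 × Fin m) where
  Adj p q := p ≠ q ∧
    match p, q with
    | Sum.inl _, Sum.inl _ => True
    | Sum.inl a, Sum.inr x => a = l x.1 ∨ a = r x.1
    | Sum.inr x, Sum.inl a => a = l x.1 ∨ a = r x.1
    | Sum.inr x, Sum.inr y => x.1 = y.1
  symm := ⟨by
    rintro (a | x) (b | y) ⟨hne, h⟩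
    · exact ⟨hne.symm, h⟩
    · exact ⟨hne.symm, h⟩
    · exact ⟨hne.symm, h⟩
    · exact ⟨hne.symm, h.symm⟩⟩
  loopless := ⟨fun _ h => h.1 rfl⟩

namespace attachCliques

variable {A : Type} {l r : Fin 3 → A} {m : ℕ}

@[simp] theorem adj_inl_inl {a b : A} :
    (attachCliques l r m).Adj (Sum.inl a) (Sum.inl b) ↔ a ≠ b := by
  simp [attachCliques]

@[simp] theorem adj_inl_inr {a : A} {x : Fin 3 × Fin m} :
    (attachCliques l r m).Adj (Sum.inl a) (Sum.inr x) ↔ a = l x.1 ∨ a = r x.1 := by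
  simp [attachCliques]

@[simp] theorem adj_inr_inl {a : A} {x : Fin 3 × Fin m} :
    (attachCliques l r m).Adj (Sum.inr x) (Sum.inl a) ↔ a = l x.1 ∨ a = r x.1 := by
  simp [attachCliques]

@[simp] theorem adj_inr_inr {x y : Fin 3 × Fin m} :
    (attachCliques l r m).Adj (Sum.inr x) (Sum.inr y) ↔ x ≠ y ∧ x.1 = y.1 := by
  simp [attachCliques]

/-- Every vertex outside `A` is simplicial. -/
theorem adj_of_adj_inr {x : Fin 3 × Fin m} {p q : A ⊕ Fin 3 × Fin m} (hpq : p ≠ q)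
    (hp : (attachCliques l r m).Adj (Sum.inr x) p) (hq : (attachCliques l r m).Adj (Sum.inr x) q) :
    (attachCliques l r m).Adj p q := by
  rcases p with a | y <;> rcases q with b | z
  · simpa using hpq
  · rw [adj_inr_inl] at hp
    rw [adj_inr_inr] at hq
    rw [adj_inl_inr, ← hq.2]
    exact hp
  · rw [adj_inr_inl] at hq
    rw [adj_inr_inr] at hp
    rw [adj_inr_inl, ← hp.2]
    exact hq
  · rw [adj_inr_inr] at hp hq ⊢
    exact ⟨fun h => hpq (h ▸ rfl), hp.2.symm.trans hq.2⟩

theorem isChordal : IsChordal (attachCliques l r m) := by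
  refine IsChordal.of_adj_add_two fun n hn f hf hadj => ?_
  have h2 : ∀ i : ZMod n, f i ≠ f (i + 2) := by
    intro i h
    have h0 : ((2 : ℕ) : ZMod n) = 0 := by push_cast; linear_combination -(hf h)
    exact absurd (Nat.le_of_dvd (by omega) ((ZMod.natCast_eq_zero_iff 2 n).1 h0)) (by omega)
  by_cases hx : ∃ i x, f i = Sum.inr x
  · obtain ⟨i, x, hx⟩ := hx
    have e0 : i - 1 + 1 = i := by ring
    have e1 : i - 1 + 2 = i + 1 := by ring
    refine ⟨i - 1, adj_of_adj_inr (h2 _) (x := x) ?_ ?_⟩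
    · rw [← hx]
      exact (e0 ▸ hadj (i - 1)).symm
    · rw [← hx, e1]
      exact hadj i
  · push Not at hx
    have hl : ∀ i, ∃ a, f i = Sum.inl a := fun i => by
      rcases h : f i with a | x
      · exact ⟨a, rfl⟩
      · exact absurd h (hx i x)
    obtain ⟨a, ha⟩ := hl 0
    obtain ⟨b, hb⟩ := hl (0 + 2)
    refine ⟨0, ?_⟩
    have := h2 0
    rw [ha, hb] at this ⊢
    simpa using this

/-- Attaching three cliques along the edges of a path with four vertices in `K₄` yields a strongly
chordal graph. -/
theorem isStronglyChordal_path :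
    IsStronglyChordal (attachCliques (Fin.castSucc : Fin 3 → Fin 4) Fin.succ m) := by
  refine ⟨isChordal, fun n hn _ f hf hadj => ?_⟩
  have : NeZero n := ⟨by omega⟩
  set G := attachCliques (Fin.castSucc : Fin 3 → Fin 4) Fin.succ m with hG
  have hprev : ∀ i, G.Adj (f i) (f (i - 1)) := fun i => by
    have e0 : i - 1 + 1 = i := by ring
    exact (e0 ▸ hadj (i - 1)).symm
  -- a cycle through a vertex of one of the two outer cliques, or missing both of them
  obtain ⟨i, x, hix, hx⟩ : ∃ i x, f i = Sum.inr x ∧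
      (x.1 = 1 → ∀ j y, f j = Sum.inr y → y.1 = 1) := by
    by_cases h : ∃ i x, f i = Sum.inr x ∧ x.1 ≠ 1
    · obtain ⟨i, x, hix, hx⟩ := h
      exact ⟨i, x, hix, fun h => absurd h hx⟩
    · push Not at h
      suffices ∃ i x, f i = Sum.inr x by
        obtain ⟨i, x, hix⟩ := this
        exact ⟨i, x, hix, fun _ => h⟩
      by_contra! hno
      have hl : ∀ i, ∃ a, f i = Sum.inl a := fun i => by
        rcases h : f i with a | x
        · exact ⟨a, rfl⟩
        · exact absurd h (hno i x)
      choose g hg using hl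
      have hginj : Function.Injective g := fun i j hij => hf (by rw [hg, hg, hij])
      have := Fintype.card_le_of_injective g hginj
      rw [ZMod.card, Fintype.card_fin] at this
      omega
  have h1 := hprev i
  have h2 := hadj i
  refine exists_odd_chord_of_nested hn hf hadj i ?_
  rw [hix] at h1 h2
  generalize f (i - 1) = p at h1 ⊢
  generalize f (i + 1) = q at h2 ⊢
  have hnest : ∀ (i : Fin 3) (a b : Fin 4), (a = i.castSucc ∨ a = i.succ) →
      (b = i.castSucc ∨ b = i.succ) →
      (∀ c : Fin 3, (i = 1 → c = 1) → (a = c.castSucc ∨ a = c.succ) →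
        (b = c.castSucc ∨ b = c.succ)) ∨
      (∀ c : Fin 3, (i = 1 → c = 1) → (b = c.castSucc ∨ b = c.succ) →
        (a = c.castSucc ∨ a = c.succ)) := by decide
  have hinl : ∀ a b : Fin 4, (∀ c : Fin 3, (x.1 = 1 → c = 1) →
      (a = c.castSucc ∨ a = c.succ) → (b = c.castSucc ∨ b = c.succ)) →
      ∀ j, G.Adj (Sum.inl a) (f j) → f j = Sum.inl b ∨ G.Adj (Sum.inl b) (f j) := by
    intro a b hab j hj
    rcases hfj : f j with c | y <;> rw [hfj] at hj
    · by_cases hcb : c = b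
      · exact Or.inl (by rw [hcb])
      · exact Or.inr (adj_inl_inl.2 (Ne.symm hcb))
    · exact Or.inr (adj_inl_inr.2 (hab y.1 (fun h => hx h j y hfj) (adj_inl_inr.1 hj)))
  by_cases hpq : p = q
  · exact Or.inl fun j hj => Or.inr (hpq ▸ hj)
  have hpq' := adj_of_adj_inr hpq h1 h2
  rcases p with a | y
  · rcases q with b | z
    · rcases hnest x.1 a b (adj_inr_inl.1 h1) (adj_inr_inl.1 h2) with h | h
      · exact Or.inl (hinl a b h)
      · exact Or.inr (hinl b a h)
    · exact Or.inr fun j hj => or_iff_not_imp_left.2 fun hne =>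
        adj_of_adj_inr (Ne.symm hne) hpq'.symm hj
  · exact Or.inl fun j hj => or_iff_not_imp_left.2 fun hne =>
      adj_of_adj_inr (Ne.symm hne) hpq' hj

theorem cliqueFree_path (hm : 2 ≤ m) :
    (attachCliques (Fin.castSucc : Fin 3 → Fin 4) Fin.succ m).CliqueFree (m + 3) := by
  intro s hs
  have hcard := hs.card_eq
  by_cases hx : ∃ x, Sum.inr x ∈ s
  · obtain ⟨x, hx⟩ := hx
    have hsub : s ⊆ {Sum.inl x.1.castSucc, Sum.inl x.1.succ} ∪
        Finset.univ.image (fun t : Fin m => (Sum.inr (x.1, t) : Fin 4 ⊕ Fin 3 × Fin m)) := by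
      intro p hp
      by_cases hpx : p = Sum.inr x
      · simp [hpx]
      have hadj := hs.isClique hp hx hpx
      rcases p with a | y
      · rw [adj_inl_inr] at hadj
        rcases hadj with rfl | rfl <;> simp
      · rw [adj_inr_inr] at hadj
        simp [← hadj.2]
    have h1 := (Finset.card_le_card hsub).trans (Finset.card_union_le _ _)
    have h2 := Finset.card_image_le (s := Finset.univ)
      (f := fun t : Fin m => (Sum.inr (x.1, t) : Fin 4 ⊕ Fin 3 × Fin m))
    have h3 := Finset.card_le_two (a := (Sum.inl x.1.castSucc : Fin 4 ⊕ Fin 3 × Fin m))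
      (b := Sum.inl x.1.succ)
    rw [Finset.card_univ, Fintype.card_fin] at h2
    omega
  · have hsub : s ⊆ Finset.univ.image (Sum.inl : Fin 4 → Fin 4 ⊕ Fin 3 × Fin m) := by
      intro p hp
      rcases p with a | y
      · simp
      · exact absurd ⟨y, hp⟩ hx
    have h1 := (Finset.card_le_card hsub).trans Finset.card_image_le
    rw [Finset.card_univ, Fintype.card_fin] at h1
    omega

/-- In a strongly chordal supergraph of the graph obtained by attaching cliques to the three edges
of a triangle, one of the cliques is completely joined to the triangle. -/
theorem not_cliqueFree_of_triangle_le
    {K : SimpleGraph (Fin 3 ⊕ Fin 3 × Fin m)} (hle : attachCliques id (· + 1) m ≤ K)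
    (hK : IsStronglyChordal K) : ¬ K.CliqueFree (m + 3) := by
  obtain ⟨j, hj⟩ : ∃ j, ∀ t, K.Adj (Sum.inr (j, t)) (Sum.inl (j + 2)) := by
    by_contra! h
    choose s hs using h
    obtain ⟨i, d, -, hd3, hd6, hid⟩ := hK.2 6 le_rfl (by decide)
      (![Sum.inl 0, Sum.inr (0, s 0), Sum.inl 1, Sum.inr (1, s 1), Sum.inl 2, Sum.inr (2, s 2)] :
        Fin 6 → Fin 3 ⊕ Fin 3 × Fin m)
      (by
        intro (i : Fin 6) (j : Fin 6) hij
        fin_cases i <;> fin_cases j <;> first | rfl | simp at hij)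
      (by
        intro (i : Fin 6)
        apply hle
        fin_cases i
        · exact adj_inl_inr.2 (by simp)
        · exact adj_inr_inl.2 (by simp)
        · exact adj_inl_inr.2 (by simp)
        · exact adj_inr_inl.2 (by simp)
        · exact adj_inl_inr.2 (by simp)
        · exact adj_inr_inl.2 (by simp))
    obtain rfl : d = 3 := by omega
    have h0 := hs 0
    have h1 := hs 1
    have h2 := hs 2
    change Fin 6 at i
    fin_cases i
    · exact h1 hid.symm
    · exact h0 hid
    · exact h2 hid.symm
    · exact h1 hid
    · exact h0 hid.symm
    · exact h2 hid
  have hinj : Function.Injective (Sum.map id (Prod.mk j) :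
      Fin 3 ⊕ Fin m → Fin 3 ⊕ Fin 3 × Fin m) :=
    Function.injective_id.sumMap (Prod.mk_right_injective j)
  intro hfree
  refine hfree (Finset.univ.map ⟨_, hinj⟩) ⟨?_, by simp [add_comm]⟩
  have hcross : ∀ (a : Fin 3) (t : Fin m), K.Adj (Sum.inr (j, t)) (Sum.inl a) := by
    intro a t
    by_cases ha : a = j + 2
    · exact ha ▸ hj t
    · refine hle (adj_inr_inl.2 ?_)
      exact (by decide : ∀ a j : Fin 3, a ≠ j + 2 → a = j ∨ a = j + 1) a j ha
  intro p hp q hq hpq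
  simp only [Finset.coe_map, Set.mem_image, Finset.coe_univ, Set.mem_univ, true_and,
    Function.Embedding.coeFn_mk] at hp hq
  obtain ⟨a | t, rfl⟩ := hp <;> obtain ⟨b | u, rfl⟩ := hq
  · exact hle (adj_inl_inl.2 fun h => hpq (congrArg Sum.inl h))
  · exact (hcross _ _).symm
  · exact hcross _ _
  · exact hle (adj_inr_inr.2 ⟨fun h => hpq (congrArg Sum.inr h), rfl⟩)

theorem triangle_isMinorOf_path (m : ℕ) :
    IsMinorOf (attachCliques (id : Fin 3 → Fin 3) (· + 1) m)
      (attachCliques (Fin.castSucc : Fin 3 → Fin 4) Fin.succ m) := by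
  have hcast : ∀ j : Fin 3, (![0, 1, 2, 0] : Fin 4 → Fin 3) j.castSucc = j := by decide
  have hsucc : ∀ j : Fin 3, (![0, 1, 2, 0] : Fin 4 → Fin 3) j.succ = j + 1 := by decide
  refine isMinorOf_of_cliqueFibers (Sum.map ![0, 1, 2, 0] id) ?_ ?_ ?_
  · exact Function.Surjective.sumMap (fun j => ⟨j.castSucc, hcast j⟩) Function.surjective_id
  · rintro (a | x) (b | y) hne h
    · simpa using hne
    · simp at h
    · simp at h
    · simp_all
  · rintro (a | x) (b | y) h
    · refine ⟨Sum.inl a.castSucc, Sum.inl b.castSucc, ?_, ?_, ?_⟩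
      · simp only [Sum.map_inl, hcast]
      · simp only [Sum.map_inl, hcast]
      · simpa using h
    · rw [adj_inl_inr] at h
      rcases h with rfl | rfl
      · exact ⟨Sum.inl y.1.castSucc, Sum.inr y, by simp only [Sum.map_inl, hcast, id], rfl,
          by simp⟩
      · exact ⟨Sum.inl y.1.succ, Sum.inr y, by simp only [Sum.map_inl, hsucc], rfl, by simp⟩
    · rw [adj_inr_inl] at h
      rcases h with rfl | rfl
      · exact ⟨Sum.inr x, Sum.inl x.1.castSucc, rfl, by simp only [Sum.map_inl, hcast, id],
          by simp⟩
      · exact ⟨Sum.inr x, Sum.inl x.1.succ, rfl, by simp only [Sum.map_inl, hsucc], by simp⟩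
    · exact ⟨Sum.inr x, Sum.inr y, rfl, rfl, by simpa using h⟩

theorem sctw_path_le (hm : 2 ≤ m) :
    sctw (attachCliques (Fin.castSucc : Fin 3 → Fin 4) Fin.succ m) ≤ m + 1 :=
  Nat.sInf_le ⟨_, le_rfl, isStronglyChordal_path, cliqueFree_path hm⟩

theorem lt_sctw_triangle (m : ℕ) :
    m + 1 < sctw (attachCliques (id : Fin 3 → Fin 3) (· + 1) m) := by
  refine Nat.lt_of_succ_le (le_csInf ?_ ?_)
  · refine ⟨3 + 3 * m, ⊤, le_top, isStronglyChordal_top _, cliqueFree_of_card_lt ?_⟩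
    simp
  · rintro k ⟨K, hle, hK, hfree⟩
    by_contra! hlt
    exact not_cliqueFree_of_triangle_le hle hK (hfree.mono (by omega))

end attachCliques

theorem IsMinorOf.congr {V V' W W' : Type} {G : SimpleGraph V} {G' : SimpleGraph V'}
    {H : SimpleGraph W} {H' : SimpleGraph W'} (φ : G ≃g G') (ψ : H ≃g H') (h : IsMinorOf H G) :
    IsMinorOf H' G' := by
  obtain ⟨f, hne, hconn, hdisj, hadj⟩ := h
  refine ⟨fun w => Set.image φ (f (ψ.symm w)), fun w => (hne _).image _, fun w => ?_,
    fun w w' hww' => ?_, fun w w' hww' => ?_⟩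
  · exact (Iso.connected_iff ⟨Equiv.Set.image φ _ φ.injective, by simp [φ.map_adj_iff]⟩).1
      (hconn (ψ.symm w))
  · exact (Set.disjoint_image_iff φ.injective).2 (hdisj (ψ.symm.injective.ne hww'))
  · obtain ⟨u, hu, v, hv, huv⟩ := hadj (ψ.symm.map_adj_iff.2 hww')
    exact ⟨φ u, ⟨u, hu, rfl⟩, φ v, ⟨v, hv, rfl⟩, φ.map_adj_iff.2 huv⟩

/-- For every `k ≥ 3`, the class of graphs of strongly chordal treewidth at most `k`
is not closed under taking minors. -/
theorem statement19 (k : ℕ) (hk : 3 ≤ k) :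
    ∃ (n m : ℕ) (G : SimpleGraph (Fin n)) (H : SimpleGraph (Fin m)),
      IsMinorOf H G ∧ sctw G ≤ k ∧ k < sctw H := by
  obtain ⟨m, rfl⟩ : ∃ m, k = m + 1 := ⟨k - 1, by omega⟩
  have φ := (attachCliques (Fin.castSucc : Fin 3 → Fin 4) Fin.succ m).overFinIso rfl
  have ψ := (attachCliques (id : Fin 3 → Fin 3) (· + 1) m).overFinIso rfl
  refine ⟨_, _, _, _, (attachCliques.triangle_isMinorOf_path m).congr φ ψ, ?_, ?_⟩
  · rw [← sctw_eq_of_iso φ]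
    exact attachCliques.sctw_path_le (by omega)
  · rw [← sctw_eq_of_iso ψ]
    exact attachCliques.lt_sctw_triangle m
end
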